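/- arXiv:2012.01161 — 3 statements merged into one kernel-verified Lean document; each statement's English description precedes it below -/
import Mathlib

section
/- For every α > (ln 2)/π, ∫_0^{π/2} (cosh(x/(2α))·cos(ln(2 cos x)/(2α))) / (cosh(x/α) + cos(ln(2 cos x)/α)) dx = π/4 - (πα/2)·Σ_{n=0}^∞ (-1)^n/(e^{πα(2n+1)} - 1). -/
open Real

open Filter Topology Metric MeasureTheory

/-- The boundary values `log (1 + e^(2ix)) = log (2 cos x) + ix` of `log (1 + z)` on the unit
circle, for `|x| < π / 2`. -/
noncomputable def logBoundary (x : ℝ) : ℂ := (Real.log (2 * Real.cos x) : ℂ) + x * Complex.I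

theorem log_one_add_exp_eq_logBoundary {x : ℝ} (h1 : -(π / 2) < x) (h2 : x < π / 2) :
    Complex.log (1 + circleMap 0 1 (2 * x)) = logBoundary x := by
  have hc : 0 < 2 * Real.cos x := by
    have := Real.cos_pos_of_mem_Ioo ⟨h1, h2⟩
    positivity
  have key : 1 + circleMap 0 1 (2 * x) = Complex.exp (logBoundary x) := by
    rw [logBoundary, Complex.exp_add, ← Complex.ofReal_exp, Real.exp_log hc]
    simp only [circleMap, zero_add, Complex.ofReal_one, one_mul]
    push_cast
    rw [Complex.cos]
    have e1 : Complex.exp (2 * (x : ℂ) * Complex.I)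
        = Complex.exp (x * Complex.I) * Complex.exp (x * Complex.I) := by
      rw [← Complex.exp_add]; ring_nf
    have e2 : Complex.exp (-(x : ℂ) * Complex.I) * Complex.exp (x * Complex.I) = 1 := by
      rw [← Complex.exp_add]; simp
    rw [e1]
    linear_combination -e2
  rw [key, Complex.log_exp] <;> simp [logBoundary] <;> linarith [pi_pos]

theorem logBoundary_neg (x : ℝ) : logBoundary (-x) = (starRingEnd ℂ) (logBoundary x) := by
  simp [logBoundary]

theorem one_add_mem_slitPlane {z : ℂ} (hz : z ∈ closedBall (0 : ℂ) 1) (h : z ≠ -1) :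
    1 + z ∈ Complex.slitPlane := by
  rw [Complex.mem_slitPlane_iff]
  by_contra! hcon
  obtain ⟨h1, h2⟩ := hcon
  simp only [Complex.add_re, Complex.one_re, Complex.add_im, Complex.one_im, zero_add] at h1 h2
  have h3 : |z.re| ≤ 1 := (Complex.abs_re_le_norm z).trans (by simpa using hz)
  apply h
  apply Complex.ext
  · simp; linarith [(abs_le.1 h3).1]
  · simpa using h2

theorem tendsto_inv_add_log_one_add (c : ℂ) :
    Tendsto (fun z : ℂ => (c + Complex.log (1 + z))⁻¹) (𝓝[≠] (-1)) (𝓝 0) := by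
  refine tendsto_inv₀_cobounded.comp ?_
  rw [← tendsto_norm_atTop_iff_cobounded]
  have h1 : Tendsto (fun z : ℂ => ‖1 + z‖) (𝓝[≠] (-1)) (𝓝[≠] 0) := by
    refine tendsto_nhdsWithin_iff.2 ⟨?_, ?_⟩
    · have : Continuous fun z : ℂ => ‖1 + z‖ := by fun_prop
      simpa using (this.tendsto (-1)).mono_left nhdsWithin_le_nhds
    · filter_upwards [self_mem_nhdsWithin] with z hz h0
      apply hz
      have : 1 + z = 0 := by simpa using h0
      simpa using eq_neg_of_add_eq_zero_right this
  have h2 : Tendsto (fun z : ℂ => c.re + Real.log ‖1 + z‖) (𝓝[≠] (-1)) atBot :=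
    tendsto_atBot_add_const_left _ _ (Real.tendsto_log_nhdsNE_zero.comp h1)
  refine tendsto_atTop_mono (fun z => ?_) (tendsto_abs_atBot_atTop.comp h2)
  simpa [Complex.log_re] using Complex.abs_re_le_norm (c + Complex.log (1 + z))

/-- The real part of the resolvent `1 / (c + log (1 + z))` on the boundary circle. -/
noncomputable def resolventRe (c x : ℝ) : ℝ := ((c + logBoundary x)⁻¹).re

theorem integral_resolventRe_of_circleAverage {F : ℂ → ℂ} {c m : ℝ}
    (hF : ContinuousOn F (sphere 0 1))
    (hFc : ∀ z ∈ sphere (0 : ℂ) 1, z ≠ -1 → F z = (c + Complex.log (1 + z))⁻¹)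
    (hm : circleAverage F 0 1 = m) :
    IntervalIntegrable (resolventRe c) volume 0 (π / 2) ∧
      ∫ x in (0 : ℝ)..(π / 2), resolventRe c x = π / 2 * m := by
  set g : ℝ → ℂ := fun θ => F (circleMap 0 1 θ) with hg
  have hgc : Continuous g :=
    hF.comp_continuous (continuous_circleMap 0 1) fun θ => circleMap_mem_sphere 0 zero_le_one θ
  have hper : Function.Periodic g (2 * π) := fun θ => by
    simp only [hg, periodic_circleMap 0 1 θ]
  have hval : ∀ x : ℝ, -(π / 2) < x → x < π / 2 → g (2 * x) = (c + logBoundary x)⁻¹ := by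
    intro x h1 h2
    rw [← log_one_add_exp_eq_logBoundary h1 h2]
    refine hFc _ (circleMap_mem_sphere 0 zero_le_one _) fun h => ?_
    have := log_one_add_exp_eq_logBoundary h1 h2
    have hc := Real.cos_pos_of_mem_Ioo ⟨h1, h2⟩
    have hre := congrArg Complex.re h
    simp only [circleMap, zero_add, Complex.ofReal_one, one_mul, Complex.exp_ofReal_mul_I_re,
      Real.cos_two_mul, Complex.neg_re, Complex.one_re] at hre
    nlinarith
  have heq : Set.EqOn (fun x : ℝ => (g (2 * x)).re) (resolventRe c) (Set.uIoo 0 (π / 2)) := by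
    intro x hx
    rw [Set.uIoo_of_le (by positivity)] at hx
    simp only [resolventRe]
    rw [hval x (by linarith [hx.1, pi_pos]) hx.2]
  have heq' : Set.EqOn (fun x : ℝ => (g (-(2 * x))).re) (resolventRe c) (Set.uIoo 0 (π / 2)) := by
    intro x hx
    rw [Set.uIoo_of_le (by positivity)] at hx
    simp only [resolventRe]
    rw [← mul_neg, hval (-x) (by linarith [hx.2]) (by linarith [hx.1, pi_pos]), logBoundary_neg,
      ← Complex.conj_ofReal, ← map_add, ← map_inv₀, Complex.conj_re, Complex.conj_ofReal]
  have hc2 : Continuous fun x : ℝ => (g (2 * x)).re := by fun_prop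
  refine ⟨(hc2.intervalIntegrable _ _).congr_uIoo heq, ?_⟩
  have hre : ∫ θ in (0 : ℝ)..(2 * π), (g θ).re = 2 * π * m := by
    have h1 : ∫ θ in (0 : ℝ)..(2 * π), g θ = 2 * π * m := by
      rw [circleAverage, Complex.real_smul] at hm
      have hp : (π : ℂ) ≠ 0 := by exact_mod_cast pi_ne_zero
      rw [← hm]
      push_cast
      field_simp
      rfl
    have h2 := Complex.reCLM.intervalIntegral_comp_comm
      (hgc.intervalIntegrable (μ := volume) 0 (2 * π))
    rw [h1] at h2
    simpa using h2
  have hper' : Function.Periodic (fun θ => (g θ).re) (2 * π) := fun θ => by simp only [hper θ]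
  have hsh := hper'.intervalIntegral_add_eq 0 (-π)
  rw [zero_add, hre, show -π + 2 * π = π by ring] at hsh
  have hcr : Continuous fun θ : ℝ => (g θ).re := by fun_prop
  rw [← intervalIntegral.integral_add_adjacent_intervals (b := 0)
    (hcr.intervalIntegrable _ _) (hcr.intervalIntegrable _ _)] at hsh
  have i1 : ∫ θ in (0 : ℝ)..π, (g θ).re = 2 * ∫ x in (0 : ℝ)..(π / 2), resolventRe c x := by
    rw [← intervalIntegral.integral_congr_uIoo heq,
      intervalIntegral.integral_comp_mul_left (fun θ => (g θ).re) two_ne_zero]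
    simp [mul_div_cancel₀]
  have i2 : ∫ θ in (-π)..0, (g θ).re = 2 * ∫ x in (0 : ℝ)..(π / 2), resolventRe c x := by
    rw [← intervalIntegral.integral_congr_uIoo heq',
      intervalIntegral.integral_comp_mul_left (fun θ => (g (-θ)).re) two_ne_zero,
      intervalIntegral.integral_comp_neg (fun θ => (g θ).re)]
    simp [mul_div_cancel₀]
  rw [i1, i2] at hsh
  linarith

theorem integral_resolventRe_of_lt {c : ℝ} (hc : c < -Real.log 2) :
    IntervalIntegrable (resolventRe c) volume 0 (π / 2) ∧
      ∫ x in (0 : ℝ)..(π / 2), resolventRe c x = π / 2 * c⁻¹ := by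
  classical
  set F : ℂ → ℂ := Function.update (fun z => ((c : ℂ) + Complex.log (1 + z))⁻¹) (-1) 0 with hFdef
  have hne : ∀ z ∈ closedBall (0 : ℂ) 1, z ≠ -1 → (c : ℂ) + Complex.log (1 + z) ≠ 0 := by
    intro z hz h h0
    have h1 := congrArg Complex.re h0
    simp only [Complex.add_re, Complex.ofReal_re, Complex.log_re, Complex.zero_re] at h1
    have h2 : ‖1 + z‖ ≤ 2 := (norm_add_le _ _).trans (by
      have : ‖z‖ ≤ 1 := by simpa using hz
      rw [norm_one]; linarith)
    have h3 : Real.log ‖1 + z‖ ≤ Real.log 2 := Real.log_le_log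
      (norm_pos_iff.2 (Complex.slitPlane_ne_zero (one_add_mem_slitPlane hz h))) h2
    linarith
  have hd : ∀ z ∈ closedBall (0 : ℂ) 1, z ≠ -1 → DifferentiableAt ℂ F z := by
    intro z hz h
    have : DifferentiableAt ℂ (fun z => ((c : ℂ) + Complex.log (1 + z))⁻¹) z := by
      have := one_add_mem_slitPlane hz h
      have := hne z hz h
      fun_prop (disch := assumption)
    refine this.congr_of_eventuallyEq ?_
    filter_upwards [isOpen_ne.mem_nhds h] with y hy
    rw [hFdef, Function.update_of_ne hy]
  have hcont : ContinuousOn F (closedBall 0 1) := by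
    intro z hz
    by_cases h : z = -1
    · subst h
      exact (continuousAt_update_same.2 (tendsto_inv_add_log_one_add c)).continuousWithinAt
    · exact (hd z hz h).continuousAt.continuousWithinAt
  refine integral_resolventRe_of_circleAverage (F := F) (hcont.mono sphere_subset_closedBall)
    (fun z _ h => by rw [hFdef, Function.update_of_ne h]) ?_
  rw [circleAverage_of_differentiable_on_off_countable Set.countable_empty (by simpa using hcont)]
  · rw [hFdef, Function.update_of_ne (by norm_num)]
    simp
  · intro z hz
    refine hd z (ball_subset_closedBall (by simpa using hz)) ?_
    rintro rfl
    simp at hz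

theorem integral_resolventRe_of_pos {c : ℝ} (hc : 0 < c) :
    IntervalIntegrable (resolventRe c) volume 0 (π / 2) ∧
      ∫ x in (0 : ℝ)..(π / 2), resolventRe c x = π / 2 * (c⁻¹ - (Real.exp c - 1)⁻¹) := by
  classical
  set p : ℂ := Complex.exp (-c) - 1 with hp
  have hpr : p = ((Real.exp (-c) - 1 : ℝ) : ℂ) := by rw [hp]; push_cast; rfl
  have he1 : Real.exp (-c) < 1 := by rw [Real.exp_lt_one_iff]; linarith
  have he0 : 0 < Real.exp (-c) := Real.exp_pos _
  have hp0 : p ≠ 0 := by rw [hpr]; exact_mod_cast (by linarith : Real.exp (-c) - 1 < 0).ne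
  have hpn : ‖p‖ < 1 := by
    rw [hpr, Complex.norm_real, Real.norm_eq_abs, abs_lt]; constructor <;> linarith
  have hpb : p ∈ ball (0 : ℂ) 1 := by simpa using hpn
  have hp1 : p ≠ -1 := by rintro h; rw [h] at hpn; simp at hpn
  set h : ℂ → ℂ := fun z => Complex.log (1 + z) with hh
  have h1p : 1 + p = Complex.exp (-c) := by rw [hp]; ring
  have hlp : h p = -c := by
    simp only [hh]
    rw [h1p, Complex.log_exp] <;> simp [pi_pos, pi_pos.le]
  have hslit : ∀ z ∈ closedBall (0 : ℂ) 1, z ≠ -1 → 1 + z ∈ Complex.slitPlane :=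
    fun z hz hz1 => one_add_mem_slitPlane hz hz1
  have hdp : HasDerivAt h (Complex.exp (-c))⁻¹ p := by
    have := ((hasDerivAt_id p).const_add 1).clog (hslit p (ball_subset_closedBall hpb) hp1)
    simp only [id] at this
    rwa [h1p, one_div] at this
  set U : Set ℂ := {z | 1 + z ∈ Complex.slitPlane} with hU
  have hUo : IsOpen U := Complex.isOpen_slitPlane.preimage (by fun_prop)
  have hpU : p ∈ U := hslit p (ball_subset_closedBall hpb) hp1
  have hdU : DifferentiableOn ℂ (dslope h p) U := by
    rw [Complex.differentiableOn_dslope (hUo.mem_nhds hpU)]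
    intro z hz
    have : 1 + z ∈ Complex.slitPlane := hz
    have : DifferentiableAt ℂ h z := by
      simp only [hh]
      fun_prop (disch := assumption)
    exact this.differentiableWithinAt
  have hsl : ∀ z, z ≠ p → dslope h p z = (c + h z) / (z - p) := by
    intro z hz
    rw [dslope_of_ne _ hz, slope_def_field, hlp]; ring
  have hnz : ∀ z ∈ U, dslope h p z ≠ 0 := by
    intro z hz
    by_cases hzp : z = p
    · rw [hzp, dslope_same, hdp.deriv]
      exact inv_ne_zero (Complex.exp_ne_zero _)
    · rw [hsl z hzp]
      refine div_ne_zero (fun h0 => hzp ?_) (sub_ne_zero.2 hzp)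
      have h2 : Complex.log (1 + z) = -c := eq_neg_of_add_eq_zero_right h0
      have h3 := Complex.exp_log (Complex.slitPlane_ne_zero hz)
      rw [h2, ← h1p] at h3
      exact (add_left_cancel h3).symm
  set H : ℂ → ℂ := Function.update (fun z => (dslope h p z)⁻¹) (-1) 0 with hH
  have hd : ∀ z ∈ closedBall (0 : ℂ) 1, z ≠ -1 → DifferentiableAt ℂ H z := by
    intro z hz h
    have hzU : z ∈ U := hslit z hz h
    refine (((hdU z hzU).differentiableAt (hUo.mem_nhds hzU)).inv
      (hnz z hzU)).congr_of_eventuallyEq ?_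
    filter_upwards [isOpen_ne.mem_nhds h] with y hy
    rw [hH, Function.update_of_ne hy]
    rfl
  have hcont : ContinuousOn H (closedBall 0 1) := by
    intro z hz
    by_cases h : z = -1
    · subst h
      refine (continuousAt_update_same.2 ?_).continuousWithinAt
      have ht : Tendsto (fun z : ℂ => (z - p) * ((c : ℂ) + Complex.log (1 + z))⁻¹)
          (𝓝[≠] (-1)) (𝓝 ((-1 - p) * 0)) :=
        Tendsto.mul (((by fun_prop : Continuous fun z : ℂ => z - p).tendsto _).mono_left
          nhdsWithin_le_nhds) (tendsto_inv_add_log_one_add c)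
      rw [mul_zero] at ht
      refine ht.congr' ?_
      filter_upwards [nhdsWithin_le_nhds (isOpen_ne.mem_nhds hp1.symm)] with y hy
      rw [hsl y hy, inv_div, div_eq_mul_inv]
    · exact (hd z hz h).continuousAt.continuousWithinAt
  have hsp : ∀ z ∈ sphere (0 : ℂ) 1, z - p ≠ 0 := by
    intro z hz h0
    rw [sub_eq_zero.1 h0] at hz
    simp only [mem_sphere_iff_norm, sub_zero] at hz
    linarith
  refine integral_resolventRe_of_circleAverage (F := fun z => H z / (z - p)) ?_ ?_ ?_
  · exact (hcont.mono sphere_subset_closedBall).div (by fun_prop) hsp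
  · intro z hz hz1
    have h1 := hsp z hz
    rw [hH, Function.update_of_ne hz1, hsl z (sub_ne_zero.1 h1), inv_div]
    simp only [hh]
    field_simp
  · have hdb : ∀ z ∈ ball (0 : ℂ) |1| \ ∅, DifferentiableAt ℂ H z := by
      intro z hz
      refine hd z (ball_subset_closedBall (by simpa using hz)) ?_
      rintro rfl
      simp at hz
    have a1 := circleAverage_sub_sub_inv_smul_of_differentiable_on_off_countable (w := p)
      Set.countable_empty (by simpa using hcont) hdb (by simpa using hpn)
    have a2 := circleAverage_of_differentiable_on_off_countable
      Set.countable_empty (by simpa using hcont) hdb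
    have hHs : ContinuousOn H (sphere 0 |1|) := by
      simpa using hcont.mono sphere_subset_closedBall
    have a3 : circleAverage (fun z => H z / (z - p)) 0 1
        = circleAverage (p⁻¹ • ((fun z => ((z - 0) / (z - p)) • H z) - H)) 0 1 := by
      refine circleAverage_congr_sphere fun z hz => ?_
      have := hsp z (by simpa using hz)
      simp only [Pi.smul_apply, Pi.sub_apply, smul_eq_mul, sub_zero]
      field_simp
      ring
    have hk : ContinuousOn (fun z => ((z - 0) / (z - p)) • H z) (sphere 0 |1|) :=
      ContinuousOn.smul (ContinuousOn.div (f := fun z => z - 0) (g := fun z => z - p)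
        (by fun_prop) (by fun_prop) (by simpa using hsp)) hHs
    rw [a3, circleAverage_smul, circleAverage_sub hk.circleIntegrable' hHs.circleIntegrable', a1, a2]
    have v1 : H p = Complex.exp (-c) := by
      rw [hH, Function.update_of_ne hp1, dslope_same, hdp.deriv, inv_inv]
    have v2 : H 0 = -p / c := by
      rw [hH, Function.update_of_ne (by norm_num), hsl 0 hp0.symm, inv_div]
      simp [hh]
    rw [v1, v2, hpr, ← Complex.ofReal_neg, ← Complex.ofReal_exp, smul_eq_mul]
    norm_cast
    have hm : Real.exp c * Real.exp (-c) = 1 := by rw [← Real.exp_add]; simp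
    have n1 : Real.exp (-c) - 1 ≠ 0 := by linarith
    have n2 : Real.exp c - 1 ≠ 0 := by nlinarith
    field_simp
    linear_combination c * hm

/-- The odd part `1 / (c + w) - 1 / (-c + w)` of the resolvent, real part on the boundary circle. -/
noncomputable def resolventDiffRe (c x : ℝ) : ℝ := resolventRe c x - resolventRe (-c) x

theorem integral_resolventDiffRe {c : ℝ} (hc : Real.log 2 < c) :
    IntervalIntegrable (resolventDiffRe c) volume 0 (π / 2) ∧
      ∫ x in (0 : ℝ)..(π / 2), resolventDiffRe c x
        = π / 2 * (2 * c⁻¹ - (Real.exp c - 1)⁻¹) := by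
  have hc0 : 0 < c := (Real.log_pos one_lt_two).trans hc
  obtain ⟨h1, h2⟩ := integral_resolventRe_of_pos hc0
  obtain ⟨h3, h4⟩ := integral_resolventRe_of_lt (neg_lt_neg hc)
  refine ⟨h1.sub h3, ?_⟩
  simp only [resolventDiffRe]
  rw [intervalIntegral.integral_sub h1 h3, h2, h4, inv_neg]
  ring

theorem hasSum_inv_cos {α : ℝ} (hα : 0 < α) {w : ℂ}
    (h1 : 1 / 4 - w / (4 * π * α) ∈ Complex.integerComplement)
    (h2 : 1 / 4 + w / (4 * π * α) ∈ Complex.integerComplement) :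
    HasSum (fun n : ℕ =>
      (((π * α * (4 * n + 5) : ℝ) : ℂ) + w)⁻¹ - (((-(π * α * (4 * n + 5)) : ℝ) : ℂ) + w)⁻¹
      - ((((π * α * (4 * n + 3) : ℝ) : ℂ) + w)⁻¹ - (((-(π * α * (4 * n + 3)) : ℝ) : ℂ) + w)⁻¹))
      (1 / (2 * α) * (Complex.cos (w / (2 * α)))⁻¹
        - ((((π * α : ℝ) : ℂ) + w)⁻¹ - (((-(π * α) : ℝ) : ℂ) + w)⁻¹)) := by
  have hα' : (α : ℂ) ≠ 0 := by exact_mod_cast hα.ne'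
  have hπ : (π : ℂ) ≠ 0 := by exact_mod_cast pi_ne_zero
  have scale : ∀ k : ℂ, (1 / 4 + w / (4 * π * α) + k)⁻¹
      = 4 * π * α * (π * α * (4 * k + 1) + w)⁻¹ := by
    intro k
    rw [show 1 / 4 + w / (4 * π * α) + k = ((4 : ℂ) * π * α)⁻¹ * (π * α * (4 * k + 1) + w) by
      field_simp; ring, mul_inv, inv_inv]
  have scale' : ∀ k : ℂ, (1 / 4 - w / (4 * π * α) + k)⁻¹
      = -(4 * π * α * (-(π * α * (4 * k + 1)) + w)⁻¹) := by
    intro k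
    rw [show 1 / 4 - w / (4 * π * α) + k = -((4 : ℂ) * π * α)⁻¹ * (-(π * α * (4 * k + 1)) + w) by
      field_simp; ring, mul_inv, inv_neg, inv_inv]
    ring
  have e1 := (summable_cotTerm h1).hasSum
  have e2 := (summable_cotTerm h2).hasSum
  rw [← cot_series_rep' h1] at e1
  rw [← cot_series_rep' h2] at e2
  have key : π * Complex.cot (π * (1 / 4 - w / (4 * π * α)))
      + π * Complex.cot (π * (1 / 4 + w / (4 * π * α)))
      = 2 * π * (Complex.cos (w / (2 * α)))⁻¹ := by
    have s1 := sin_pi_mul_ne_zero h1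
    have s2 := sin_pi_mul_ne_zero h2
    set A := π * (1 / 4 - w / (4 * π * α)) with hA
    set B := π * (1 / 4 + w / (4 * π * α)) with hB
    have hw : w / (2 * α) = B - A := by rw [hA, hB]; field_simp; ring
    have hAB : A + B = π / 2 := by rw [hA, hB]; ring
    have c0 : Complex.cos A * Complex.cos B = Complex.sin A * Complex.sin B := by
      have := Complex.cos_add A B
      rw [hAB, Complex.cos_pi_div_two] at this
      linear_combination -this
    have c1 : Complex.cos A * Complex.sin B + Complex.sin A * Complex.cos B = 1 := by
      have := Complex.sin_add A B
      rw [hAB, Complex.sin_pi_div_two] at this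
      linear_combination -this
    have c2 : Complex.cos (w / (2 * α)) = 2 * (Complex.sin A * Complex.sin B) := by
      rw [hw, Complex.cos_sub]
      linear_combination c0
    rw [c2, Complex.cot, Complex.cot]
    field_simp
    linear_combination c1
  have e3 := ((e1.add e2).mul_left (4 * π * α : ℂ)⁻¹)
  convert e3 using 1
  · rfl
  · funext n
    simp only [cotTerm, one_div (_ + _), one_div (_ - _)]
    have t1 := scale' (-(n + 1))
    have t2 := scale' (n + 1)
    have t3 := scale (-(n + 1))
    have t4 := scale (n + 1)
    simp only [sub_eq_add_neg] at t1 t2 t3 t4 ⊢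
    rw [t1, t2, t3, t4]
    push_cast
    rw [show -((π : ℂ) * α * (4 * -((n : ℂ) + 1) + 1)) = π * α * (4 * n + 3) by ring,
      show (π : ℂ) * α * (4 * -((n : ℂ) + 1) + 1) = -(π * α * (4 * n + 3)) by ring,
      show (π : ℂ) * α * (4 * ((n : ℂ) + 1) + 1) = π * α * (4 * n + 5) by ring]
    field_simp
    ring
  · have t1 := scale' 0
    have t2 := scale 0
    simp only [add_zero, mul_zero, zero_add, mul_one] at t1 t2
    rw [one_div (_ - _), one_div (_ + _), t1, t2]
    rw [show ∀ a b c d : ℂ, a - b + (c - d) = a + c - (b + d) by intros; ring, key]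
    push_cast
    field_simp
    ring

theorem re_inv_cos_logBoundary (α x : ℝ) :
    ((Complex.cos (logBoundary x / (2 * α)))⁻¹).re
      = 2 * ((Real.cosh (x / (2*α)) * Real.cos (Real.log (2 * Real.cos x) / (2*α)))
          / (Real.cosh (x/α) + Real.cos (Real.log (2 * Real.cos x) / α))) := by
  set A := Real.log (2 * Real.cos x) / (2 * α) with hA
  set B := x / (2 * α) with hB
  have h1 : logBoundary x / (2 * α) = A + B * Complex.I := by
    rw [hA, hB, logBoundary]; push_cast; ring
  have h2 : x / α = 2 * B := by rw [hB]; ring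
  have h3 : Real.log (2 * Real.cos x) / α = 2 * A := by rw [hA]; ring
  rw [h1, h2, h3, Complex.inv_re, Complex.cos_add_mul_I, Complex.normSq_apply]
  simp only [← Complex.ofReal_cos, ← Complex.ofReal_sin, ← Complex.ofReal_cosh,
    ← Complex.ofReal_sinh, ← Complex.ofReal_mul, Complex.sub_re, Complex.sub_im,
    Complex.ofReal_re, Complex.ofReal_im, Complex.re_ofReal_mul, Complex.im_ofReal_mul,
    Complex.I_re, Complex.I_im]
  have h4 : Real.cosh (2 * B) + Real.cos (2 * A)
      = 2 * ((Real.cos A * Real.cosh B - Real.sin A * Real.sinh B * 0)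
        * (Real.cos A * Real.cosh B - Real.sin A * Real.sinh B * 0)
        + (0 - Real.sin A * Real.sinh B * 1) * (0 - Real.sin A * Real.sinh B * 1)) := by
    rw [Real.cosh_two_mul, Real.cos_two_mul]
    have := Real.sin_sq A
    have h5 := Real.cosh_sq B
    ring_nf
    rw [this, h5]
    ring
  rw [h4]
  field_simp
  ring

theorem hasSum_resolventDiffRe {α x : ℝ} (hα : 0 < α) (hx : 0 < x) :
    HasSum (fun n : ℕ =>
        resolventDiffRe (π * α * (4 * n + 5)) x - resolventDiffRe (π * α * (4 * n + 3)) x)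
      (((Real.cosh (x / (2*α)) * Real.cos (Real.log (2 * Real.cos x) / (2*α)))
          / (Real.cosh (x/α) + Real.cos (Real.log (2 * Real.cos x) / α))) / α
        - resolventDiffRe (π * α) x) := by
  have him : (logBoundary x / (4 * π * α)).im = x / (4 * π * α) := by
    rw [show (4 * π * α : ℂ) = ((4 * π * α : ℝ) : ℂ) by push_cast; rfl, Complex.div_ofReal_im]
    simp [logBoundary]
  have hne : x / (4 * π * α) ≠ 0 := by positivity
  have h := Complex.hasSum_re (hasSum_inv_cos hα (w := logBoundary x)
    (fun ⟨n, hn⟩ => hne ?_) (fun ⟨n, hn⟩ => hne ?_))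
  · convert h using 1
    · funext n
      simp only [resolventDiffRe, resolventRe, Complex.sub_re]
    have := re_inv_cos_logBoundary α x
    rw [show (1 / (2 * α) : ℂ) = ((1 / (2 * α) : ℝ) : ℂ) by push_cast; rfl, Complex.sub_re,
      Complex.re_ofReal_mul, this]
    simp only [resolventDiffRe, resolventRe, Complex.sub_re]
    field_simp
  · have := congrArg Complex.im hn
    rw [Complex.sub_im, him] at this
    simpa using this.symm
  · have := congrArg Complex.im hn
    rw [Complex.add_im, him] at this
    simpa using this.symm

theorem hasSum_two_mul_inv {α : ℝ} (hα : 0 < α) :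
    HasSum (fun n : ℕ => 2 * (π * α * (4 * n + 5))⁻¹ - 2 * (π * α * (4 * n + 3))⁻¹)
      (1 / (2 * α) - 2 * (π * α)⁻¹) := by
  have h4 : (1 / 4 : ℂ) ∈ Complex.integerComplement := by
    rintro ⟨n, hn⟩
    have h5 : (4 * n : ℂ) = 1 := by rw [hn]; norm_num
    have h6 : 4 * n = 1 := by exact_mod_cast h5
    omega
  have h := Complex.hasSum_re (hasSum_inv_cos hα (w := 0) (by simpa using h4) (by simpa using h4))
  simp only [add_zero, zero_div, Complex.cos_zero, inv_one, mul_one, ← Complex.ofReal_inv,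
    ← Complex.ofReal_sub, Complex.ofReal_re, inv_neg, Complex.sub_re] at h
  convert h using 1
  · funext n; ring
  · rw [show (1 / (2 * α) : ℂ) = ((1 / (2 * α) : ℝ) : ℂ) by push_cast; rfl, Complex.ofReal_re]
    ring

theorem le_norm_add_logBoundary {x c κ : ℝ} (hx : 0 < x) (hx' : x < π / 2) (hκ1 : κ ≤ 1)
    (hκ : κ ≤ c - Real.log 2) :
    κ ≤ ‖(c : ℂ) + logBoundary x‖ ∧ κ ≤ ‖((-c : ℝ) : ℂ) + logBoundary x‖ := by
  have hcos : 0 < Real.cos x := Real.cos_pos_of_mem_Ioo ⟨by linarith, hx'⟩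
  have hre : ∀ c : ℝ, ((c : ℂ) + logBoundary x).re = c + Real.log (2 * Real.cos x) := by
    intro c; simp [logBoundary]
  have him : ∀ c : ℝ, ((c : ℂ) + logBoundary x).im = x := by
    intro c; simp [logBoundary]
  constructor
  · rcases le_total x (π / 3) with h | h
    · have h1 : 1 / 2 ≤ Real.cos x := by
        rw [← Real.cos_pi_div_three]
        exact Real.cos_le_cos_of_nonneg_of_le_pi hx.le (by linarith [pi_pos]) h
      have h2 : 0 ≤ Real.log (2 * Real.cos x) := Real.log_nonneg (by linarith)
      refine le_trans ?_ (Complex.re_le_norm _)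
      rw [hre]
      linarith [Real.log_pos one_lt_two]
    · refine le_trans ?_ ((le_abs_self _).trans (Complex.abs_im_le_norm _))
      rw [him]
      linarith [pi_gt_three]
  · refine le_trans ?_ ((neg_le_abs _).trans (Complex.abs_re_le_norm _))
    rw [hre]
    have : Real.log (2 * Real.cos x) ≤ Real.log 2 :=
      Real.log_le_log (by positivity) (by linarith [Real.cos_le_one x])
    linarith

theorem norm_inv_ofReal_add_le {w : ℂ} {c κ : ℝ} (hc : c ≠ 0) (hκ : 0 < κ)
    (h : κ ≤ ‖(c : ℂ) + w‖) : ‖((c : ℂ) + w)⁻¹‖ ≤ (1 + ‖w‖ / κ) / |c| := by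
  have h0 : 0 < ‖(c : ℂ) + w‖ := hκ.trans_le h
  have h1 : |c| ≤ ‖(c : ℂ) + w‖ + ‖w‖ := by
    have := norm_sub_le ((c : ℂ) + w) w
    simpa using this
  have h2 : ‖w‖ ≤ ‖(c : ℂ) + w‖ * (‖w‖ / κ) := by
    rw [mul_div_assoc', le_div_iff₀ hκ]
    nlinarith [norm_nonneg w]
  rw [norm_inv, inv_eq_one_div, div_le_div_iff₀ h0 (abs_pos.2 hc)]
  nlinarith

theorem norm_inv_sub_inv_ofReal_add_le {w : ℂ} {a b κ : ℝ} (ha : a ≠ 0) (hb : b ≠ 0) (hκ : 0 < κ)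
    (h1 : κ ≤ ‖(a : ℂ) + w‖) (h2 : κ ≤ ‖(b : ℂ) + w‖) :
    ‖((a : ℂ) + w)⁻¹ - ((b : ℂ) + w)⁻¹‖ ≤ |b - a| * (1 + ‖w‖ / κ) ^ 2 / (|a| * |b|) := by
  have n1 : (a : ℂ) + w ≠ 0 := norm_pos_iff.1 (hκ.trans_le h1)
  have n2 : (b : ℂ) + w ≠ 0 := norm_pos_iff.1 (hκ.trans_le h2)
  have e : ((a : ℂ) + w)⁻¹ - ((b : ℂ) + w)⁻¹
      = ((b - a : ℝ) : ℂ) * (((a : ℂ) + w)⁻¹ * ((b : ℂ) + w)⁻¹) := by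
    push_cast
    field_simp
    ring
  rw [e, norm_mul, norm_mul, Complex.norm_real, Real.norm_eq_abs]
  calc |b - a| * (‖((a : ℂ) + w)⁻¹‖ * ‖((b : ℂ) + w)⁻¹‖)
      ≤ |b - a| * ((1 + ‖w‖ / κ) / |a| * ((1 + ‖w‖ / κ) / |b|)) := by
        gcongr
        · exact norm_inv_ofReal_add_le ha hκ h1
        · exact norm_inv_ofReal_add_le hb hκ h2
    _ = _ := by field_simp

theorem abs_resolventDiffRe_sub_le {α x κ : ℝ} (hα : 0 < α) (hx : 0 < x) (hx' : x < π / 2)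
    (hκ0 : 0 < κ) (hκ1 : κ ≤ 1) (hκ : κ ≤ π * α - Real.log 2) (n : ℕ) :
    |resolventDiffRe (π * α * (4 * n + 5)) x - resolventDiffRe (π * α * (4 * n + 3)) x|
      ≤ 4 / (π * α) * (1 + ‖logBoundary x‖ / κ) ^ 2 * (1 / ((n : ℝ) + 1) ^ 2) := by
  have hn : (0 : ℝ) ≤ n := n.cast_nonneg
  have hpa : 0 < π * α := by positivity
  set a := π * α * (4 * n + 5) with ha
  set b := π * α * (4 * n + 3) with hb
  have hab : a - b = 2 * (π * α) := by rw [ha, hb]; ring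
  have hb' : π * α * (n + 1) ≤ b := by rw [hb]; gcongr; linarith; norm_num
  have hb0 : 0 < π * α * (n + 1) := by positivity
  have hbp : π * α ≤ b := by rw [hb]; nlinarith [mul_nonneg hpa.le hn]
  have ha' : π * α * (n + 1) ≤ a := by linarith
  have A := le_norm_add_logBoundary hx hx' hκ1 (c := a) (by linarith)
  have B := le_norm_add_logBoundary hx hx' hκ1 (c := b) (by linarith)
  have h1 := norm_inv_sub_inv_ofReal_add_le (by linarith : a ≠ 0) (by linarith : b ≠ 0) hκ0 A.1 B.1
  have h2 := norm_inv_sub_inv_ofReal_add_le (by linarith : -a ≠ 0) (by linarith : -b ≠ 0) hκ0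
    A.2 B.2
  rw [abs_neg, abs_neg, show -b - -a = a - b by ring] at h2
  rw [abs_sub_comm b a] at h1
  rw [hab, abs_of_pos (by positivity), abs_of_pos (by linarith : 0 < a),
    abs_of_pos (by linarith : 0 < b)] at h1 h2
  have h3 : 2 * (π * α) * (1 + ‖logBoundary x‖ / κ) ^ 2 / (a * b)
      ≤ 2 * (π * α) * (1 + ‖logBoundary x‖ / κ) ^ 2 / (π * α * (n + 1) * (π * α * (n + 1))) := by
    gcongr
  have h4 := (Complex.abs_re_le_norm _).trans h1
  have h5 := (Complex.abs_re_le_norm _).trans h2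
  rw [Complex.sub_re] at h4 h5
  have h6 : resolventDiffRe a x - resolventDiffRe b x
      = (resolventRe a x - resolventRe b x) - (resolventRe (-a) x - resolventRe (-b) x) := by
    simp only [resolventDiffRe]; ring
  rw [h6]
  refine (abs_sub _ _).trans ?_
  refine (add_le_add (h4.trans h3) (h5.trans h3)).trans (le_of_eq ?_)
  field_simp
  ring

theorem measurable_logBoundary : Measurable logBoundary := by
  unfold logBoundary
  fun_prop

theorem norm_logBoundary_le {x : ℝ} (hx : 0 < x) (hx' : x < π / 2) :
    1 ≤ (1 - 2 / π * x) ^ (-(1 / 4) : ℝ) ∧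
      ‖logBoundary x‖ ≤ 7 * (1 - 2 / π * x) ^ (-(1 / 4) : ℝ) := by
  have hcos : 0 < Real.cos x := Real.cos_pos_of_mem_Ioo ⟨by linarith, hx'⟩
  have ht := Real.one_sub_mul_le_cos hx.le hx'.le
  set t := 1 - 2 / π * x with htd
  have ht0 : 0 < t := by
    have : 2 / π * x < 2 / π * (π / 2) := by gcongr
    rw [show 2 / π * (π / 2) = 1 by field_simp] at this
    linarith
  have ht1 : t ≤ 1 := by
    have : 0 < 2 / π * x := by positivity
    linarith
  have hs : 1 ≤ t ^ (-(1 / 4) : ℝ) :=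
    Real.one_le_rpow_of_pos_of_le_one_of_nonpos ht0 ht1 (by norm_num)
  refine ⟨hs, ?_⟩
  have h1 := Real.abs_log_mul_self_rpow_lt t (1 / 4) ht0 ht1 (by norm_num)
  have h2 : -Real.log t ≤ 4 * t ^ (-(1 / 4) : ℝ) := by
    have h3 : -Real.log t * t ^ (1 / 4 : ℝ) ≤ 4 := by
      rw [neg_mul]
      exact ((neg_le_abs _).trans h1.le).trans (by norm_num)
    rw [Real.rpow_neg ht0.le, ← div_eq_mul_inv, le_div_iff₀ (by positivity)]
    exact h3
  have h4 : Real.log t ≤ Real.log (Real.cos x) := Real.log_le_log ht0 ht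
  have h5 : Real.log (Real.cos x) ≤ 0 := Real.log_nonpos hcos.le (Real.cos_le_one x)
  have h6 : |Real.log (2 * Real.cos x)| ≤ 1 + 4 * t ^ (-(1 / 4) : ℝ) := by
    rw [Real.log_mul two_ne_zero hcos.ne', abs_le]
    have := Real.log_two_lt_d9
    have := Real.log_pos one_lt_two
    constructor <;> linarith
  have h7 : ‖logBoundary x‖ ≤ |Real.log (2 * Real.cos x)| + |x| := by
    refine (norm_add_le _ _).trans (le_of_eq ?_)
    simp
  rw [abs_of_pos hx] at h7
  linarith [pi_lt_four]

theorem intervalIntegrable_sq_norm_logBoundary {κ : ℝ} (hκ : 0 < κ) :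
    IntervalIntegrable (fun x => (1 + ‖logBoundary x‖ / κ) ^ 2) volume 0 (π / 2) := by
  have hr : IntervalIntegrable (fun x : ℝ => (1 - 2 / π * x) ^ (-(1 / 2) : ℝ)) volume
      0 (π / 2) := by
    have h1 : IntervalIntegrable (fun y : ℝ => y ^ (-(1 / 2) : ℝ)) volume 1 0 :=
      intervalIntegral.intervalIntegrable_rpow' (by norm_num)
    have h2 := (h1.comp_sub_left 1).comp_mul_left (c := 2 / π)
    simpa using h2
  have hm : Measurable fun x => (1 + ‖logBoundary x‖ / κ) ^ 2 := by
    have := measurable_logBoundary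
    fun_prop
  refine (hr.const_mul ((1 + 7 / κ) ^ 2)).mono_fun' hm.aestronglyMeasurable ?_
  rw [Set.uIoc_of_le (by positivity), ← restrict_Ioo_eq_restrict_Ioc]
  refine (ae_restrict_iff' measurableSet_Ioo).2 (ae_of_all _ fun x hx => ?_)
  obtain ⟨h1, h2⟩ := norm_logBoundary_le hx.1 hx.2
  have ht0 : 0 ≤ 1 - 2 / π * x := by
    have : 2 / π * x ≤ 2 / π * (π / 2) := by gcongr; exact hx.2.le
    rw [show 2 / π * (π / 2) = 1 by field_simp] at this
    linarith
  have h3 : 1 + ‖logBoundary x‖ / κ ≤ (1 + 7 / κ) * (1 - 2 / π * x) ^ (-(1 / 4) : ℝ) := by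
    have : ‖logBoundary x‖ / κ ≤ 7 * (1 - 2 / π * x) ^ (-(1 / 4) : ℝ) / κ := by gcongr
    calc _ ≤ (1 - 2 / π * x) ^ (-(1 / 4) : ℝ) + 7 * (1 - 2 / π * x) ^ (-(1 / 4) : ℝ) / κ :=
          add_le_add h1 this
      _ = _ := by ring
  simp only [Real.norm_eq_abs]
  rw [abs_of_nonneg (by positivity)]
  calc _ ≤ ((1 + 7 / κ) * (1 - 2 / π * x) ^ (-(1 / 4) : ℝ)) ^ 2 := by gcongr
    _ = _ := by
      rw [mul_pow, ← Real.rpow_mul_natCast ht0]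
      norm_num

theorem summable_alternating_lambert {c : ℝ} (hc : 0 < c) :
    Summable fun n : ℕ => (-1 : ℝ) ^ n / (Real.exp (c * (2 * n + 1)) - 1) := by
  refine Summable.of_norm_bounded (g := fun n => (Real.exp c - 1)⁻¹ * (Real.exp c)⁻¹ ^ n)
    ((summable_geometric_of_lt_one (by positivity)
      (inv_lt_one_of_one_lt₀ (Real.one_lt_exp_iff.2 hc))).mul_left _) fun n => ?_
  have hE : 1 < Real.exp c := Real.one_lt_exp_iff.2 hc
  have e : Real.exp (c * (2 * n + 1)) = Real.exp c ^ (2 * n + 1) := by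
    rw [← Real.exp_nat_mul]; push_cast; ring_nf
  have h1 : (Real.exp c - 1) * Real.exp c ^ n ≤ Real.exp c ^ (2 * n + 1) - 1 := by
    have h2 : Real.exp c ^ (n + 1) ≤ Real.exp c ^ (2 * n + 1) :=
      pow_le_pow_right₀ hE.le (by omega)
    have h3 : 1 ≤ Real.exp c ^ n := one_le_pow₀ hE.le
    rw [pow_succ] at h2
    linarith
  have h0 : 0 < (Real.exp c - 1) * Real.exp c ^ n := mul_pos (by linarith) (by positivity)
  rw [e, norm_div, norm_pow, norm_neg, norm_one, one_pow, Real.norm_eq_abs,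
    abs_of_pos (h0.trans_le h1), inv_pow, ← mul_inv, one_div]
  exact inv_anti₀ h0 h1

theorem stmt_8 (α : ℝ) (hα : Real.log 2 / π < α) :
    ∫ x in (0:ℝ)..(π/2),
        (Real.cosh (x / (2*α)) * Real.cos (Real.log (2 * Real.cos x) / (2*α)))
          / (Real.cosh (x/α) + Real.cos (Real.log (2 * Real.cos x) / α))
      = π/4 - (π * α / 2) * ∑' n : ℕ, (-1)^n / (Real.exp (π * α * (2*n+1)) - 1) := by
  have hlog : Real.log 2 < π * α := by rwa [div_lt_iff₀' pi_pos] at hα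
  have hlog0 := Real.log_pos one_lt_two
  have hα0 : 0 < α := pos_of_mul_pos_right (hlog0.trans hlog) pi_pos.le
  have hpa : 0 < π * α := by positivity
  have hp2 : 0 ≤ π / 2 := by positivity
  set I : ℝ → ℝ := fun x =>
    (Real.cosh (x / (2*α)) * Real.cos (Real.log (2 * Real.cos x) / (2*α)))
      / (Real.cosh (x/α) + Real.cos (Real.log (2 * Real.cos x) / α)) with hI
  obtain ⟨κ, hκ0, hκ1, hκ⟩ : ∃ κ : ℝ, 0 < κ ∧ κ ≤ 1 ∧ κ ≤ π * α - Real.log 2 :=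
    ⟨min 1 (π * α - Real.log 2), lt_min one_pos (by linarith), min_le_left _ _, min_le_right _ _⟩
  have hlt : ∀ j : ℝ, 1 ≤ j → Real.log 2 < π * α * j := fun j hj => by nlinarith
  have hodd : ∀ (k : ℝ) (_ : 1 ≤ k) (n : ℕ), Real.log 2 < π * α * (4 * n + k) := fun k hk n =>
    hlt _ (by have : (0 : ℝ) ≤ n := n.cast_nonneg
              linarith)
  have hK1 := integral_resolventDiffRe hlog
  have hK5 := fun n : ℕ => integral_resolventDiffRe (hodd 5 (by norm_num) n)
  have hK3 := fun n : ℕ => integral_resolventDiffRe (hodd 3 (by norm_num) n)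
  set bound : ℕ → ℝ → ℝ := fun n x =>
    4 / (π * α) * (1 + ‖logBoundary x‖ / κ) ^ 2 * (1 / ((n : ℝ) + 1) ^ 2) with hbound
  have hsq : Summable fun n : ℕ => 1 / ((n : ℝ) + 1) ^ 2 := by
    have := (summable_nat_add_iff 1).2 (Real.summable_one_div_nat_pow.2 one_lt_two)
    simpa using this
  have hbs : ∀ x, Summable fun n => bound n x := fun x => hsq.mul_left _
  have hbi : IntervalIntegrable (fun x => ∑' n, bound n x) volume 0 (π / 2) := by
    simp only [hbound, tsum_mul_left]
    exact ((intervalIntegrable_sq_norm_logBoundary hκ0).const_mul _).mul_const _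
  have hIoo : ∀ᵐ x : ℝ, x ∈ Set.uIoc 0 (π / 2) → x ∈ Set.Ioo 0 (π / 2) := by
    have : ∀ᵐ x : ℝ, x ≠ π / 2 := by simp [ae_iff]
    filter_upwards [this] with x hx hx'
    rw [Set.uIoc_of_le (by positivity)] at hx'
    exact ⟨hx'.1, lt_of_le_of_ne hx'.2 hx⟩
  have hb : ∀ n : ℕ, ∀ x ∈ Set.Ioo 0 (π / 2),
      ‖resolventDiffRe (π * α * (4 * n + 5)) x - resolventDiffRe (π * α * (4 * n + 3)) x‖
        ≤ bound n x :=
    fun n x hx => abs_resolventDiffRe_sub_le hα0 hx.1 hx.2 hκ0 hκ1 hκ n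
  have hs := intervalIntegral.hasSum_integral_of_dominated_convergence
    (μ := volume) (a := 0) (b := π / 2)
    (F := fun (n : ℕ) x =>
      resolventDiffRe (π * α * (4 * n + 5)) x - resolventDiffRe (π * α * (4 * n + 3)) x)
    (f := fun x => I x / α - resolventDiffRe (π * α) x) bound
    (fun n => by
      rw [Set.uIoc_of_le hp2]
      exact ((hK5 n).1.sub (hK3 n).1).aestronglyMeasurable)
    (fun n => hIoo.mono fun x h hx => hb n x (h hx))
    (ae_of_all _ fun x _ => hbs x) hbi
    (hIoo.mono fun x h hx => hasSum_resolventDiffRe hα0 (h hx).1)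
  have hImeas : Measurable I := by
    simp only [hI]
    fun_prop
  have hdi : IntervalIntegrable (fun x => I x / α - resolventDiffRe (π * α) x) volume
      0 (π / 2) := by
    refine hbi.mono_fun' ((hImeas.div_const α).aestronglyMeasurable.sub
      (by rw [Set.uIoc_of_le hp2]; exact hK1.1.aestronglyMeasurable)) ?_
    refine (ae_restrict_iff' measurableSet_uIoc).2 (hIoo.mono fun x h hx => ?_)
    exact (hasSum_resolventDiffRe hα0 (h hx).1).norm_le_of_bounded (hbs x).hasSum
      fun n => hb n x (h hx)
  have hIi : IntervalIntegrable (fun x => I x / α) volume 0 (π / 2) := by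
    refine (hdi.add hK1.1).congr fun x _ => ?_
    simp
  rw [intervalIntegral.integral_sub hIi hK1.1, hK1.2, intervalIntegral.integral_div] at hs
  simp only [intervalIntegral.integral_sub (hK5 _).1 (hK3 _).1, (hK5 _).2, (hK3 _).2] at hs
  have hs0 := (hasSum_two_mul_inv hα0).mul_left (π / 2)
  have hs1 := (hs0.sub hs).mul_left (2 / π)
  set a : ℕ → ℝ := fun n => (-1) ^ n / (Real.exp (π * α * (2 * n + 1)) - 1) with ha
  have hsum : Summable a := summable_alternating_lambert hpa
  have hev : Summable fun n => a (2 * n + 1) :=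
    hsum.comp_injective (i := fun n => 2 * n + 1) fun m n h => by simpa using h
  have hod : Summable fun n => a (2 * n + 1 + 1) :=
    hsum.comp_injective (i := fun n => 2 * n + 1 + 1) fun m n h => by simpa using h
  have hpair := (hev.hasSum.add hod.hasSum)
  rw [tsum_even_add_odd (f := fun n => a (n + 1)) hev hod] at hpair
  have hterm : (fun n => a (2 * n + 1) + a (2 * n + 1 + 1)) = fun n : ℕ => 2 / π *
      (π / 2 * (2 * (π * α * (4 * n + 5))⁻¹ - 2 * (π * α * (4 * n + 3))⁻¹)
        - (π / 2 * (2 * (π * α * (4 * n + 5))⁻¹ - (Real.exp (π * α * (4 * n + 5)) - 1)⁻¹)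
          - π / 2 * (2 * (π * α * (4 * n + 3))⁻¹ - (Real.exp (π * α * (4 * n + 3)) - 1)⁻¹))) := by
    funext n
    have o1 : (-1 : ℝ) ^ (2 * n + 1) = -1 := by rw [pow_succ, pow_mul]; norm_num
    have o2 : (-1 : ℝ) ^ (2 * n + 1 + 1) = 1 := by rw [pow_succ, o1]; norm_num
    simp only [ha, o1, o2]
    push_cast
    rw [show π * α * (2 * (2 * (n : ℝ) + 1) + 1) = π * α * (4 * n + 3) by ring,
      show π * α * (2 * (2 * (n : ℝ) + 1 + 1) + 1) = π * α * (4 * n + 5) by ring]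
    rw [show ∀ p q r s : ℝ, 2 / π * (π / 2 * (2 * p - 2 * q) - (π / 2 * (2 * p - r)
      - π / 2 * (2 * q - s))) = (2 / π * (π / 2)) * (r - s) by intros; ring,
      show 2 / π * (π / 2) = 1 by field_simp]
    ring
  rw [hterm] at hpair
  have hfin := hpair.unique hs1
  have htsum : ∑' n, a n = a 0 + ∑' n, a (n + 1) := hsum.tsum_eq_zero_add
  have ha0 : a 0 = (Real.exp (π * α) - 1)⁻¹ := by simp [ha]
  rw [htsum, ha0, hfin]
  field_simp
  ring
end

section
/- For every α > (ln 2)/π, ∫_0^{π/2} (sin 2x · sinh(x/α)) / (cosh(x/α) + cos(ln(2 cos x)/α)) dx = π/(8α) + πα/(4 sinh(πα)) - (πα/8)·Σ_{n=0}^∞ 1/sinh²(πα(2n+1)/2). -/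
open Real
open Complex Metric Set Filter Topology MeasureTheory

lemma one_add_mem_slitPlane_of_norm_le_one {z : ℂ} (hz : ‖z‖ ≤ 1) (h : z ≠ -1) :
    1 + z ∈ Complex.slitPlane := by
  left
  by_contra! hle
  have hre : z.re ≤ -1 := by
    have : 1 + z.re ≤ 0 := by simpa using hle
    linarith
  have hsq : z.re * z.re + z.im * z.im ≤ 1 := by
    have := Complex.normSq_eq_norm_sq z
    rw [Complex.normSq_apply] at this
    rw [this]; nlinarith [norm_nonneg z]
  apply h
  apply Complex.ext
  · simp; nlinarith
  · simp; nlinarith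

lemma circleIntegral_one_sub_sq_inv_mul {h : ℂ → ℂ} (hc : ContinuousOn h (closedBall 0 1))
    (hd : DifferentiableOn ℂ h (ball 0 1)) :
    (∮ z in C(0, 1), (1 - 1 / z ^ 2) * h z) = -(2 * π * I * deriv h 0) := by
  have hd0 : ∀ z ∈ ball (0 : ℂ) 1, DifferentiableAt ℂ h z := fun z hz =>
    hd.differentiableAt (isOpen_ball.mem_nhds hz)
  have h0 : (0 : ℂ) ∈ ball (0 : ℂ) 1 := by simp
  have hcs : ContinuousOn (dslope h 0) (closedBall 0 1) :=
    (continuousOn_dslope (closedBall_mem_nhds _ one_pos)).2 ⟨hc, hd0 0 h0⟩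
  have i1 : (∮ z in C(0, 1), h z) = 0 :=
    Complex.circleIntegral_eq_zero_of_differentiable_on_off_countable zero_le_one
      countable_empty hc (fun z hz => hd0 z hz.1)
  have i2 : (∮ z in C(0, 1), h 0 * (z - 0) ^ (-2 : ℤ)) = 0 := by
    rw [circleIntegral.integral_const_mul, circleIntegral.integral_sub_zpow_of_ne (by norm_num),
      mul_zero]
  have i3 : (∮ z in C(0, 1), (z - 0)⁻¹ • dslope h 0 z) = (2 * π * I : ℂ) • deriv h 0 := by
    rw [Complex.circleIntegral_sub_inv_smul_of_differentiable_on_off_countable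
      (countable_singleton (0 : ℂ)) h0 hcs, dslope_same]
    intro z hz
    exact (differentiableAt_dslope_of_ne hz.2).2 (hd0 z hz.1)
  have hne : ∀ z ∈ sphere (0 : ℂ) 1, z ≠ 0 := fun z hz => ne_of_mem_sphere hz one_ne_zero
  have c1 : CircleIntegrable h 0 1 :=
    (hc.mono sphere_subset_closedBall).circleIntegrable zero_le_one
  have c2 : CircleIntegrable (fun z : ℂ => h 0 * (z - 0) ^ (-2 : ℤ)) 0 1 := by
    apply ContinuousOn.circleIntegrable zero_le_one
    intro z hz
    refine (continuousAt_const.mul (ContinuousAt.zpow₀ (by fun_prop) _ (Or.inl ?_))).continuousWithinAt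
    simpa using hne z hz
  have c3 : CircleIntegrable (fun z : ℂ => (z - 0)⁻¹ • dslope h 0 z) 0 1 := by
    apply ContinuousOn.circleIntegrable zero_le_one
    refine ContinuousOn.smul (ContinuousOn.inv₀ (continuousOn_id.sub continuousOn_const) ?_) (hcs.mono sphere_subset_closedBall)
    intro z hz
    simpa using hne z hz
  have key : (∮ z in C(0, 1), (1 - 1 / z ^ 2) * h z) =
      ∮ z in C(0, 1), (h z - h 0 * (z - 0) ^ (-2 : ℤ) - (z - 0)⁻¹ • dslope h 0 z) := by
    apply circleIntegral.integral_congr zero_le_one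
    intro z hz
    have hz0 := hne z hz
    have := sub_smul_dslope h 0 z
    simp only [smul_eq_mul, sub_zero] at this ⊢
    rw [show h z = h 0 + z * dslope h 0 z by rw [this]; ring]
    rw [zpow_neg, zpow_ofNat]
    field_simp
    ring
  rw [key, circleIntegral.integral_sub (f := fun z => h z - h 0 * (z - 0) ^ (-2 : ℤ)) (c1.sub c2) c3,
    circleIntegral.integral_sub c1 c2, i1, i2, i3]
  simp

lemma circleIntegral_one_sub_sq_inv_mul_sub_inv {p : ℂ} (hp : p ∈ ball (0 : ℂ) 1) (hp0 : p ≠ 0) :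
    (∮ z in C(0, 1), (1 - 1 / z ^ 2) * (z - p)⁻¹) = 2 * π * I := by
  have hne : ∀ z ∈ sphere (0 : ℂ) 1, ∀ w ∈ ball (0 : ℂ) 1, z - w ≠ 0 := by
    rintro z hz w hw h
    rw [sub_eq_zero.1 h] at hz
    simp at hz hw; linarith
  have h0 : (0 : ℂ) ∈ ball (0 : ℂ) 1 := by simp
  have cinv : ∀ w ∈ ball (0 : ℂ) 1, CircleIntegrable (fun z : ℂ => (z - w)⁻¹) 0 1 := by
    intro w hw
    apply ContinuousOn.circleIntegrable zero_le_one
    exact ContinuousOn.inv₀ (by fun_prop) fun z hz => hne z hz w hw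
  have c2 : CircleIntegrable (fun z : ℂ => (z - 0) ^ (-2 : ℤ)) 0 1 := by
    apply ContinuousOn.circleIntegrable zero_le_one
    intro z hz
    exact (ContinuousAt.zpow₀ (f := fun z : ℂ => z - 0) (by fun_prop) _
      (Or.inl (hne z hz 0 h0))).continuousWithinAt
  have key : (∮ z in C(0, 1), (1 - 1 / z ^ 2) * (z - p)⁻¹) =
      ∮ z in C(0, 1), ((1 - 1 / p ^ 2) * (z - p)⁻¹ + (1 / p ^ 2) * (z - 0)⁻¹ +
        (1 / p) * (z - 0) ^ (-2 : ℤ)) := by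
    apply circleIntegral.integral_congr zero_le_one
    intro z hz
    have h1 := hne z hz p hp
    have h2 := hne z hz 0 h0
    simp only [sub_zero] at h2 ⊢
    rw [zpow_neg, zpow_ofNat]
    field_simp
    ring
  have cc : ∀ {f : ℂ → ℂ} (a : ℂ), CircleIntegrable f 0 1 →
      CircleIntegrable (fun z => a * f z) 0 1 := fun a hf => hf.const_mul a
  rw [key, circleIntegral.integral_add
      (f := fun z => (1 - 1 / p ^ 2) * (z - p)⁻¹ + (1 / p ^ 2) * (z - 0)⁻¹)
      ((cc _ (cinv p hp)).add (cc _ (cinv 0 h0))) (cc _ c2),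
    circleIntegral.integral_add (cc _ (cinv p hp)) (cc _ (cinv 0 h0)),
    circleIntegral.integral_const_mul, circleIntegral.integral_const_mul,
    circleIntegral.integral_const_mul, circleIntegral.integral_sub_zpow_of_ne (by norm_num),
    circleIntegral.integral_sub_inv_of_mem_ball hp, circleIntegral.integral_sub_inv_of_mem_ball h0]
  ring

lemma circleIntegral_im_eq {g : ℂ → ℂ} (hg : ContinuousOn g (sphere 0 1))
    (hconj : ∀ z ∈ sphere (0 : ℂ) 1, (g (star z)).im = -(g z).im) :
    (∮ z in C(0, 1), (1 - 1 / z ^ 2) * g z).im =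
      -8 * ∫ x in (0 : ℝ)..(π / 2), Real.sin (2 * x) * (g (Complex.exp (2 * x * I))).im := by
  set F : ℝ → ℝ := fun θ => Real.sin θ * (g (Complex.exp (θ * I))).im with hF
  have hmem : ∀ θ : ℝ, Complex.exp (θ * I) ∈ sphere (0 : ℂ) 1 := fun θ => by
    simp [Complex.norm_exp_ofReal_mul_I]
  have hgc : Continuous fun θ : ℝ => g (Complex.exp (θ * I)) := by
    refine hg.comp_continuous (by fun_prop) hmem
  have hFc : Continuous F := by
    exact Real.continuous_sin.mul (Complex.continuous_im.comp hgc)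
  have h1 : (∮ z in C(0, 1), (1 - 1 / z ^ 2) * g z) =
      ∫ θ in (0 : ℝ)..2 * π, -2 * Complex.sin θ * g (Complex.exp (θ * I)) := by
    rw [circleIntegral]
    apply intervalIntegral.integral_congr
    intro θ _
    have he : Complex.exp (θ * I) ≠ 0 := Complex.exp_ne_zero _
    simp only [deriv_circleMap, circleMap_zero, ofReal_one, one_mul, smul_eq_mul]
    rw [Complex.sin, neg_mul (θ : ℂ) I, Complex.exp_neg]
    field_simp
    ring
  have h2 : (∮ z in C(0, 1), (1 - 1 / z ^ 2) * g z).im =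
      ∫ θ in (0 : ℝ)..2 * π, -2 * F θ := by
    rw [h1]
    have := (Complex.imCLM).intervalIntegral_comp_comm (μ := volume) (a := 0) (b := 2 * π)
      (f := fun θ : ℝ => -2 * Complex.sin θ * g (Complex.exp (θ * I)))
      (Continuous.intervalIntegrable (Continuous.mul (by fun_prop) hgc) _ _)
    simp only [Complex.imCLM_apply] at this
    rw [← this]
    apply intervalIntegral.integral_congr
    intro θ _
    simp only [hF]
    rw [← Complex.ofReal_sin, show (-2 : ℂ) * (Real.sin θ : ℂ) = ((-2 * Real.sin θ : ℝ) : ℂ) by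
      push_cast; ring, Complex.im_ofReal_mul]
    ring
  have hsymm : ∀ θ, F (2 * π - θ) = F θ := by
    intro θ
    simp only [hF]
    have he : Complex.exp (((2 * π - θ : ℝ) : ℂ) * I) = star (Complex.exp (θ * I)) := by
      rw [Complex.star_def, ← Complex.exp_conj]
      simp only [map_mul, Complex.conj_ofReal, Complex.conj_I]
      push_cast
      rw [sub_mul, sub_eq_add_neg, Complex.exp_add, Complex.exp_two_pi_mul_I]
      simp
    rw [he, hconj _ (hmem θ), Real.sin_two_pi_sub]
    ring
  have h3 : ∫ θ in π..2 * π, F θ = ∫ θ in (0 : ℝ)..π, F θ := by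
    have := intervalIntegral.integral_comp_sub_left (a := 0) (b := π) F (2 * π)
    simp only [hsymm] at this
    rw [this]
    congr 1 <;> ring
  have h4 : ∫ θ in (0 : ℝ)..π, F θ = 2 * ∫ x in (0 : ℝ)..(π / 2), F (2 * x) := by
    rw [intervalIntegral.integral_comp_mul_left F two_ne_zero]
    simp
    congr 1; ring
  rw [h2, intervalIntegral.integral_const_mul,
    ← intervalIntegral.integral_add_adjacent_intervals (hFc.intervalIntegrable 0 π)
      (hFc.intervalIntegrable π (2 * π)), h3, h4]
  simp only [hF]
  push_cast
  ring

lemma tendsto_inv_sub_log_one_add (c : ℂ) :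
    Tendsto (fun z : ℂ => (c - Complex.log (1 + z))⁻¹) (𝓝[≠] (-1)) (𝓝 0) := by
  refine tendsto_inv₀_cobounded.comp ?_
  rw [← tendsto_norm_atTop_iff_cobounded]
  have h1 : Tendsto (fun z : ℂ => ‖1 + z‖) (𝓝[≠] (-1)) (𝓝[≠] 0) := by
    refine tendsto_nhdsWithin_iff.2 ⟨?_, ?_⟩
    · have : ContinuousAt (fun z : ℂ => ‖1 + z‖) (-1) := by fun_prop
      simpa [ContinuousAt] using this.tendsto.mono_left nhdsWithin_le_nhds
    · filter_upwards [self_mem_nhdsWithin] with z hz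
      simp only [mem_compl_iff, mem_singleton_iff, norm_eq_zero]
      intro h
      exact hz (by rw [mem_singleton_iff]; linear_combination h)
  have h2 := tendsto_neg_atBot_atTop.comp (Real.tendsto_log_nhdsNE_zero.comp h1)
  refine tendsto_atTop_mono ?_ (tendsto_atTop_add_const_right _ c.re h2)
  intro z
  have := Complex.re_le_norm (c - Complex.log (1 + z))
  simp only [Complex.sub_re, Complex.log_re] at this
  simp only [Function.comp]
  linarith

/-- The function `1 / (c - log (1 + z))`, extended continuously by `0` to `z = -1`. -/
noncomputable def invSubLog (c : ℝ) (z : ℂ) : ℂ :=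
  Function.update (fun z : ℂ => ((c : ℂ) - Complex.log (1 + z))⁻¹) (-1) 0 z

lemma invSubLog_of_ne (c : ℝ) {z : ℂ} (hz : z ≠ -1) :
    invSubLog c z = ((c : ℂ) - Complex.log (1 + z))⁻¹ := by
  simp [invSubLog, hz]

lemma eventuallyEq_invSubLog (c : ℝ) {z : ℂ} (hz : z ≠ -1) :
    invSubLog c =ᶠ[𝓝 z] fun z => ((c : ℂ) - Complex.log (1 + z))⁻¹ := by
  filter_upwards [isOpen_ne.mem_nhds hz] with w hw using invSubLog_of_ne c hw

lemma exp_eq_of_sub_log_eq_zero {c : ℝ} {z : ℂ} (hz : ‖z‖ ≤ 1) (h1 : z ≠ -1)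
    (h : (c : ℂ) - Complex.log (1 + z) = 0) : z = (Real.exp c - 1 : ℝ) := by
  have hs := Complex.slitPlane_ne_zero (one_add_mem_slitPlane_of_norm_le_one hz h1)
  have := Complex.exp_log hs
  rw [← sub_eq_zero.1 h] at this
  push_cast
  rw [this]; ring

lemma continuousAt_invSubLog_neg_one (c : ℝ) : ContinuousAt (invSubLog c) (-1) :=
  continuousAt_update_same.2 (tendsto_inv_sub_log_one_add c)

lemma hasDerivAt_inv_sub_log {c : ℝ} {z : ℂ} (hz : ‖z‖ ≤ 1) (h1 : z ≠ -1)
    (h : (c : ℂ) - Complex.log (1 + z) ≠ 0) :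
    HasDerivAt (fun z : ℂ => ((c : ℂ) - Complex.log (1 + z))⁻¹)
      ((1 + z)⁻¹ / ((c : ℂ) - Complex.log (1 + z)) ^ 2) z := by
  have hs := one_add_mem_slitPlane_of_norm_le_one hz h1
  convert! ((((hasDerivAt_id z).const_add 1).clog hs).const_sub (c : ℂ)).inv h using 1
  simp

lemma differentiableAt_invSubLog {c : ℝ} {z : ℂ} (hz : ‖z‖ ≤ 1) (h1 : z ≠ -1)
    (h : z ≠ (Real.exp c - 1 : ℝ)) : DifferentiableAt ℂ (invSubLog c) z :=
  ((hasDerivAt_inv_sub_log hz h1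
    (fun h0 => h (exp_eq_of_sub_log_eq_zero hz h1 h0))).differentiableAt).congr_of_eventuallyEq
    (eventuallyEq_invSubLog c h1)

lemma continuousAt_invSubLog {c : ℝ} {z : ℂ} (hz : ‖z‖ ≤ 1)
    (h : z ≠ (Real.exp c - 1 : ℝ)) : ContinuousAt (invSubLog c) z := by
  by_cases h1 : z = -1
  · rw [h1]; exact continuousAt_invSubLog_neg_one c
  · exact (differentiableAt_invSubLog hz h1 h).continuousAt

lemma hasDerivAt_invSubLog_zero {c : ℝ} (hc : c ≠ 0) :
    HasDerivAt (invSubLog c) (1 / (c : ℂ) ^ 2) 0 := by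
  have := hasDerivAt_inv_sub_log (c := c) (z := 0) (by simp) (by simp) (by simpa using hc)
  simp only [add_zero, Complex.log_one, sub_zero, inv_one] at this
  exact this.congr_of_eventuallyEq (eventuallyEq_invSubLog c (by simp))

lemma ne_neg_one_of_mem_ball {z : ℂ} (hz : z ∈ ball (0 : ℂ) 1) : z ≠ -1 := by
  rintro rfl; simp at hz

lemma circleIntegral_invSubLog_of_log_two_lt {c : ℝ} (hc : Real.log 2 < c) :
    (∮ z in C(0, 1), (1 - 1 / z ^ 2) * invSubLog c z) = -(2 * π * I * (1 / (c : ℂ) ^ 2)) := by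
  have hc0 : 0 < c := (Real.log_pos one_lt_two).trans hc
  have hne : ∀ z : ℂ, ‖z‖ ≤ 1 → z ≠ (Real.exp c - 1 : ℝ) := by
    rintro z hz rfl
    have := (Real.log_lt_iff_lt_exp two_pos).1 hc
    rw [Complex.norm_real, Real.norm_eq_abs] at hz
    linarith [le_abs_self (Real.exp c - 1)]
  rw [circleIntegral_one_sub_sq_inv_mul, (hasDerivAt_invSubLog_zero hc0.ne').deriv]
  · intro z hz
    have hz : ‖z‖ ≤ 1 := by simpa using hz
    exact (continuousAt_invSubLog hz (hne z hz)).continuousWithinAt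
  · intro z hz
    have hz' : ‖z‖ ≤ 1 := le_of_lt (by simpa using hz)
    exact (differentiableAt_invSubLog hz' (ne_neg_one_of_mem_ball hz)
      (hne z hz')).differentiableWithinAt

/-- The regular part of `1 / u - 1 / (exp u - 1)` at `u = 0`. -/
noncomputable def expRem (u : ℂ) : ℂ :=
  dslope (dslope Complex.exp 0) 0 u / dslope Complex.exp 0 u

lemma differentiable_dslope {f : ℂ → ℂ} (hf : Differentiable ℂ f) (a : ℂ) :
    Differentiable ℂ (dslope f a) := by
  rw [← differentiableOn_univ] at hf ⊢
  exact (Complex.differentiableOn_dslope univ_mem).2 hf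

lemma exp_sub_one_eq_mul_dslope (u : ℂ) : Complex.exp u - 1 = u * dslope Complex.exp 0 u := by
  simpa using (sub_smul_dslope Complex.exp 0 u).symm

lemma dslope_exp_ne_zero {u : ℂ} (hu : |u.im| < 2 * π) : dslope Complex.exp 0 u ≠ 0 := by
  by_cases h0 : u = 0
  · subst h0; rw [dslope_same]; simp
  intro h
  have := exp_sub_one_eq_mul_dslope u
  rw [h, mul_zero, sub_eq_zero, Complex.exp_eq_one_iff] at this
  obtain ⟨n, hn⟩ := this
  have him : u.im = n * (2 * π) := by rw [hn]; simp
  rw [him, abs_mul, abs_of_pos two_pi_pos] at hu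
  have h1 : |(n : ℝ)| < 1 := by
    by_contra! h; nlinarith [two_pi_pos]
  have : n = 0 := by
    have : |n| < 1 := by exact_mod_cast h1
    exact Int.abs_lt_one_iff.1 this
  apply h0; rw [hn, this]; simp

lemma expRem_eq {u : ℂ} (hu : |u.im| < 2 * π) (h0 : u ≠ 0) :
    expRem u = u⁻¹ - (Complex.exp u - 1)⁻¹ := by
  have h1 := dslope_exp_ne_zero hu
  have h2 : dslope Complex.exp 0 u - 1 = u * dslope (dslope Complex.exp 0) 0 u := by
    simpa [dslope_same] using (sub_smul_dslope (dslope Complex.exp 0) 0 u).symm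
  rw [expRem, exp_sub_one_eq_mul_dslope]
  field_simp
  linear_combination -h2

lemma differentiableAt_expRem {u : ℂ} (hu : |u.im| < 2 * π) : DifferentiableAt ℂ expRem u :=
  (differentiable_dslope (differentiable_dslope Complex.differentiable_exp 0) 0 u).div
    (differentiable_dslope Complex.differentiable_exp 0 u) (dslope_exp_ne_zero hu)

lemma circleIntegral_invSubLog_of_neg {c : ℝ} (hc : c < 0) :
    (∮ z in C(0, 1), (1 - 1 / z ^ 2) * invSubLog c z) =
      -(2 * π * I * (1 / (c : ℂ) ^ 2 +
        (Real.exp c : ℂ) * (1 - 1 / ((Real.exp c - 1 : ℝ) : ℂ) ^ 2))) := by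
  set p : ℂ := ((Real.exp c - 1 : ℝ) : ℂ) with hp
  have hec : Real.exp c < 1 := Real.exp_lt_one_iff.2 hc
  have hec0 : 0 < Real.exp c := Real.exp_pos c
  have hpb : p ∈ ball (0 : ℂ) 1 := by
    simp only [hp, mem_ball, dist_zero_right, Complex.norm_real, Real.norm_eq_abs, abs_lt]
    constructor <;> linarith
  have hp0 : p ≠ 0 := by
    rw [hp, Complex.ofReal_ne_zero]; linarith
  have hps : ∀ z ∈ sphere (0 : ℂ) 1, z ≠ p := by
    rintro z hz rfl
    simp at hz hpb; linarith
  have him : ∀ z : ℂ, |(Complex.log (1 + z) - c).im| < 2 * π := by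
    intro z
    have := Complex.abs_arg_le_pi (1 + z)
    simp only [Complex.sub_im, Complex.log_im, Complex.ofReal_im, sub_zero]
    linarith [pi_pos]
  set h : ℂ → ℂ := Function.update (fun z => -expRem (Complex.log (1 + z) - c)) (-1) (-1) with hh
  have hK : ∀ z : ℂ, z ≠ -1 → z ≠ p → h z = invSubLog c z + Real.exp c * (z - p)⁻¹ := by
    intro z hz hzp
    have h1 : 1 + z ≠ 0 := fun h0 => hz (by linear_combination h0)
    have hu : Complex.log (1 + z) - c ≠ 0 := by
      intro h0
      apply hzp
      have := Complex.exp_log h1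
      rw [sub_eq_zero.1 h0] at this
      rw [hp]; push_cast; rw [this]; ring
    simp only [hh, Function.update_of_ne hz]
    rw [expRem_eq (him z) hu, invSubLog_of_ne _ hz, Complex.exp_sub, Complex.exp_log h1,
      ← neg_sub (Complex.log (1 + z)) (c : ℂ), inv_neg]
    have hE : Complex.exp c ≠ 0 := Complex.exp_ne_zero _
    have : (1 + z) / Complex.exp c - 1 = (z - p) / Complex.exp c := by
      rw [hp]; push_cast; field_simp; ring
    rw [this]
    push_cast
    field_simp
    ring
  have hdiff : ∀ z : ℂ, ‖z‖ ≤ 1 → z ≠ -1 → DifferentiableAt ℂ h z := by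
    intro z hz hz1
    have e : h =ᶠ[𝓝 z] fun z => -expRem (Complex.log (1 + z) - c) := by
      filter_upwards [isOpen_ne.mem_nhds hz1] with w hw using by simp [hh, hw]
    refine DifferentiableAt.congr_of_eventuallyEq ?_ e
    refine DifferentiableAt.neg (DifferentiableAt.comp z (differentiableAt_expRem (him z)) ?_)
    exact (DifferentiableAt.clog (by fun_prop)
      (one_add_mem_slitPlane_of_norm_le_one hz hz1)).sub_const _
  have hcont : ContinuousAt h (-1) := by
    rw [hh, continuousAt_update_same]
    have hm1 : (-1 : ℂ) ≠ p := hps _ (by simp)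
    have hm1' : (-1 : ℂ) - p ≠ 0 := sub_ne_zero.2 hm1
    have t1 := tendsto_inv_sub_log_one_add (c : ℂ)
    have t2 : Tendsto (fun z : ℂ => (Real.exp c : ℂ) * (z - p)⁻¹) (𝓝[≠] (-1)) (𝓝 (-1)) := by
      have : ContinuousAt (fun z : ℂ => (Real.exp c : ℂ) * (z - p)⁻¹) (-1) := by
        fun_prop (disch := exact hm1')
      have h' := this.tendsto.mono_left (nhdsWithin_le_nhds (s := {-1}ᶜ))
      convert! h' using 2
      rw [eq_comm, mul_inv_eq_iff_eq_mul₀ hm1', hp]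
      push_cast; ring
    have t3 := t1.add t2
    rw [zero_add] at t3
    refine t3.congr' ?_
    filter_upwards [self_mem_nhdsWithin,
      nhdsWithin_le_nhds (isOpen_ne.mem_nhds hm1)] with z hz hzp
    have := hK z hz hzp
    simp only [hh, Function.update_of_ne hz] at this
    rw [this, invSubLog_of_ne _ hz]
  have hd0 : deriv h 0 = 1 / (c : ℂ) ^ 2 - Real.exp c / p ^ 2 := by
    have e : h =ᶠ[𝓝 0] fun z => invSubLog c z + Real.exp c * (z - p)⁻¹ := by
      filter_upwards [isOpen_ne.mem_nhds (show (0 : ℂ) ≠ -1 by simp),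
        isOpen_ne.mem_nhds hp0.symm] with w h1 h2 using hK w h1 h2
    rw [e.deriv_eq]
    have d2 : HasDerivAt (fun z : ℂ => (z - p)⁻¹) (-1 / (0 - p) ^ 2) 0 :=
      ((hasDerivAt_id (0 : ℂ)).sub_const p).inv (by simpa using hp0)
    refine (((hasDerivAt_invSubLog_zero hc.ne).add (d2.const_mul (Real.exp c : ℂ))).deriv).trans ?_
    ring
  have hhc : ContinuousOn h (closedBall 0 1) := by
    intro z hz
    by_cases h1 : z = -1
    · rw [h1]; exact hcont.continuousWithinAt
    · exact (hdiff z (by simpa using hz) h1).continuousAt.continuousWithinAt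
  have hsq : ContinuousOn (fun z : ℂ => 1 - 1 / z ^ 2) (sphere 0 1) := by
    refine continuousOn_const.sub (continuousOn_const.div (by fun_prop) fun z hz => ?_)
    exact pow_ne_zero 2 (ne_of_mem_sphere hz one_ne_zero)
  have i1 := circleIntegral_one_sub_sq_inv_mul hhc (fun z hz => (hdiff z
    (le_of_lt (by simpa using hz)) (ne_neg_one_of_mem_ball hz)).differentiableWithinAt)
  have i2 := circleIntegral_one_sub_sq_inv_mul_sub_inv hpb hp0
  have c1 : CircleIntegrable (fun z : ℂ => (1 - 1 / z ^ 2) * h z) 0 1 :=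
    (hsq.mul (hhc.mono sphere_subset_closedBall)).circleIntegrable zero_le_one
  have c2 : CircleIntegrable (fun z : ℂ => (Real.exp c : ℂ) * ((1 - 1 / z ^ 2) * (z - p)⁻¹)) 0 1 := by
    refine (continuousOn_const.mul (hsq.mul (ContinuousOn.inv₀ (by fun_prop) ?_))).circleIntegrable
      zero_le_one
    exact fun z hz => sub_ne_zero.2 (hps z hz)
  have key : (∮ z in C(0, 1), (1 - 1 / z ^ 2) * invSubLog c z) =
      ∮ z in C(0, 1), ((1 - 1 / z ^ 2) * h z -
        (Real.exp c : ℂ) * ((1 - 1 / z ^ 2) * (z - p)⁻¹)) := by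
    apply circleIntegral.integral_congr zero_le_one
    intro z hz
    simp only
    by_cases hz1 : z = -1
    · subst hz1; simp
    · rw [hK z hz1 (hps z hz)]; ring
  rw [key, circleIntegral.integral_sub c1 c2, circleIntegral.integral_const_mul, i1, i2, hd0]
  ring

lemma im_invSubLog_star (c : ℝ) {z : ℂ} (hz : ‖z‖ ≤ 1) :
    (invSubLog c (star z)).im = -(invSubLog c z).im := by
  by_cases h1 : z = -1
  · subst h1; simp [invSubLog]
  have h2 : star z ≠ -1 := by
    intro h
    apply h1
    rw [← star_star z, h]; simp
  have ha : (1 + z).arg ≠ π :=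
    (Complex.mem_slitPlane_iff_arg.1 (one_add_mem_slitPlane_of_norm_le_one hz h1)).1
  rw [invSubLog_of_ne _ h1, invSubLog_of_ne _ h2, Complex.star_def, ← Complex.conj_im, map_inv₀,
    map_sub, Complex.conj_ofReal, ← Complex.log_conj _ ha]
  simp

lemma continuousOn_invSubLog_sphere {c : ℝ} (hc : Real.log 2 < c ∨ c < 0) :
    ContinuousOn (invSubLog c) (sphere 0 1) := by
  intro z hz
  have hz : ‖z‖ = 1 := by simpa using hz
  refine (continuousAt_invSubLog hz.le ?_).continuousWithinAt
  rintro rfl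
  rw [Complex.norm_real, Real.norm_eq_abs] at hz
  rcases hc with hc | hc
  · have := (Real.log_lt_iff_lt_exp two_pos).1 hc
    linarith [le_abs_self (Real.exp c - 1)]
  · rw [abs_of_neg (by linarith [Real.exp_lt_one_iff.2 hc])] at hz
    linarith [Real.exp_pos c]

lemma exp_neg_mul_one_sub_eq {c : ℝ} (hc : 0 < c) :
    Real.exp (-c) * (1 - 1 / (Real.exp (-c) - 1) ^ 2) =
      Real.exp (-c) - 1 / (4 * Real.sinh (c / 2) ^ 2) := by
  have h1 : Real.exp (-c) = ((Real.exp (c / 2)) ^ 2)⁻¹ := by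
    rw [← Real.exp_nat_mul, ← Real.exp_neg]; congr 1; push_cast; ring
  have ht : 1 < Real.exp (c / 2) := Real.one_lt_exp_iff.2 (by linarith)
  rw [Real.sinh_eq, h1, Real.exp_neg]
  set t := Real.exp (c / 2)
  have h2 : t ^ 2 - 1 ≠ 0 := by nlinarith
  have h3 : 1 - t ^ 2 ≠ 0 := by nlinarith
  have ht0 : t ≠ 0 := by linarith
  have e1 : (t ^ 2)⁻¹ - 1 = (1 - t ^ 2) / t ^ 2 := by field_simp
  have e2 : t - t⁻¹ = (t ^ 2 - 1) / t := by field_simp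
  rw [e1, e2]
  field_simp
  ring

lemma integral_sin_mul_invSubLog {c : ℝ} (hc : Real.log 2 < c) :
    ∫ x in (0 : ℝ)..(π / 2), Real.sin (2 * x) *
      (invSubLog c (Complex.exp (2 * x * I)) + invSubLog (-c) (Complex.exp (2 * x * I))).im =
      π / 4 * (2 / c ^ 2 + Real.exp (-c) - 1 / (4 * Real.sinh (c / 2) ^ 2)) := by
  have hc0 : 0 < c := (Real.log_pos one_lt_two).trans hc
  have hcn : -c < 0 := by linarith
  have k1 := continuousOn_invSubLog_sphere (Or.inl hc)
  have k2 := continuousOn_invSubLog_sphere (Or.inr hcn)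
  have hsq : ContinuousOn (fun z : ℂ => 1 - 1 / z ^ 2) (sphere 0 1) := by
    refine continuousOn_const.sub (continuousOn_const.div (by fun_prop) fun z hz => ?_)
    exact pow_ne_zero 2 (ne_of_mem_sphere hz one_ne_zero)
  have h := circleIntegral_im_eq (k1.add k2) (fun z hz => by
    have hz : ‖z‖ = 1 := by simpa using hz
    simp only [Pi.add_apply, Complex.add_im, im_invSubLog_star _ hz.le]
    ring)
  simp only [Pi.add_apply, mul_add] at h
  rw [circleIntegral.integral_add (f := fun z => (1 - 1 / z ^ 2) * invSubLog c z)
    (g := fun z => (1 - 1 / z ^ 2) * invSubLog (-c) z) ((hsq.mul k1).circleIntegrable zero_le_one)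
    ((hsq.mul k2).circleIntegrable zero_le_one), circleIntegral_invSubLog_of_log_two_lt hc,
    circleIntegral_invSubLog_of_neg hcn] at h
  have e : -(2 * π * I * (1 / (c : ℂ) ^ 2)) + -(2 * π * I * (1 / ((-c : ℝ) : ℂ) ^ 2 +
        (Real.exp (-c) : ℂ) * (1 - 1 / ((Real.exp (-c) - 1 : ℝ) : ℂ) ^ 2))) =
      ((-(2 * π * (2 / c ^ 2 + Real.exp (-c) * (1 - 1 / (Real.exp (-c) - 1) ^ 2))) : ℝ) : ℂ) * I := by
    push_cast; ring
  rw [e, Complex.im_ofReal_mul, Complex.I_im, mul_one, exp_neg_mul_one_sub_eq hc0] at h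
  simp only [Complex.add_im, mul_add] at h ⊢
  linarith

lemma hasSum_tan {y : ℂ} (hy : y.im ≠ 0) :
    HasSum (fun n : ℕ => ((2 * n + 1 : ℂ) - y)⁻¹ + (-(2 * n + 1 : ℂ) - y)⁻¹)
      (π / 2 * Complex.tan (π * y / 2)) := by
  have hmem : ∀ w : ℂ, w.im ≠ 0 → w ∈ Complex.integerComplement := by
    rintro w hw ⟨n, rfl⟩
    simp at hw
  have hy2 : (y / 2).im ≠ 0 := by simpa using hy
  have s1 := summable_cotTerm (hmem y hy)
  have s2 := summable_cotTerm (hmem _ hy2)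
  have r1 := cot_series_rep' (hmem y hy)
  have r2 := cot_series_rep' (hmem _ hy2)
  have ho : HasSum (fun k : ℕ => cotTerm y (2 * k + 1))
      (1 / 2 * (π * Complex.cot (π * (y / 2)) - 1 / (y / 2))) := by
    have := (s2.hasSum).mul_left (1 / 2)
    rw [show ∑' n, cotTerm (y / 2) n = π * Complex.cot (π * (y / 2)) - 1 / (y / 2) from r2.symm]
      at this
    convert! this using 2 with k
    simp only [cotTerm]
    push_cast
    rw [show y - (2 * (k : ℂ) + 1 + 1) = 2 * (y / 2 - (k + 1)) by ring,
      show y + (2 * (k : ℂ) + 1 + 1) = 2 * (y / 2 + (k + 1)) by ring]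
    simp only [one_div, mul_inv]
    ring
  have he : Summable (fun k : ℕ => cotTerm y (2 * k)) :=
    s1.comp_injective (mul_right_injective₀ (two_ne_zero' ℕ))
  have hsum := (he.hasSum.even_add_odd ho).unique s1.hasSum
  rw [show ∑' n, cotTerm y n = π * Complex.cot (π * y) - 1 / y from r1.symm] at hsum
  have hval : -(∑' k, cotTerm y (2 * k)) = π / 2 * Complex.tan (π * y / 2) := by
    rw [← eq_sub_iff_add_eq] at hsum
    rw [hsum]
    have hs : Complex.sin (π * (y / 2)) ≠ 0 := sin_pi_mul_ne_zero (hmem _ hy2)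
    have hs2 : Complex.sin (2 * (π * (y / 2))) ≠ 0 := by
      have := sin_pi_mul_ne_zero (hmem _ hy)
      rwa [show (π : ℂ) * y = 2 * (π * (y / 2)) by ring] at this
    rw [show (π : ℂ) * y / 2 = π * (y / 2) by ring, show (π : ℂ) * y = 2 * (π * (y / 2)) by ring]
    set A : ℂ := π * (y / 2)
    rw [Complex.sin_two_mul] at hs2
    have hc : Complex.cos A ≠ 0 := fun h => hs2 (by rw [h]; ring)
    have hsc := Complex.sin_sq_add_cos_sq A
    have : 2 * Complex.cot (2 * A) = Complex.cot A - Complex.tan A := by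
      rw [Complex.cot, Complex.cot, Complex.tan, Complex.sin_two_mul, Complex.cos_two_mul]
      field_simp
      linear_combination hsc
    have h1 : 1 / (y / 2) = 2 * (1 / y) := by field_simp
    rw [h1]
    linear_combination (-(π : ℂ) / 2) * this
  rw [← hval]
  convert! he.hasSum.neg using 2 with k
  simp only [cotTerm]
  push_cast
  rw [← neg_sub y, inv_neg, show -(2 * (k : ℂ) + 1) - y = -(y + (2 * k + 1)) by ring, inv_neg]
  ring

lemma log_one_add_exp_two_mul_I {x : ℝ} (hx : x ∈ Ioo (-(π / 2)) (π / 2)) :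
    Complex.log (1 + Complex.exp (2 * x * I)) = (Real.log (2 * Real.cos x) : ℂ) + x * I := by
  have hcos : 0 < Real.cos x := Real.cos_pos_of_mem_Ioo hx
  have h : 1 + Complex.exp (2 * x * I) =
      Complex.exp ((Real.log (2 * Real.cos x) : ℂ) + x * I) := by
    rw [Complex.exp_add, ← Complex.ofReal_exp, Real.exp_log (by positivity)]
    push_cast
    rw [Complex.cos, show (2 : ℂ) * x * I = x * I + x * I by ring, Complex.exp_add,
      neg_mul (x : ℂ) I, Complex.exp_neg]
    have := Complex.exp_ne_zero (x * I)
    field_simp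
    ring
  rw [h, Complex.log_exp]
  · simp; linarith [hx.1, pi_pos]
  · simp; linarith [hx.2, pi_pos]

lemma im_tan_eq (u v : ℝ) :
    (Complex.tan (u + v * I)).im =
      Real.sinh (2 * v) / (Real.cosh (2 * v) + Real.cos (2 * u)) := by
  have h1 : Complex.sin (u + v * I) =
      ((Real.sin u * Real.cosh v : ℝ) : ℂ) + ((Real.cos u * Real.sinh v : ℝ) : ℂ) * I := by
    rw [Complex.sin_add_mul_I]; push_cast; ring
  have h2 : Complex.cos (u + v * I) =
      ((Real.cos u * Real.cosh v : ℝ) : ℂ) + ((-(Real.sin u * Real.sinh v) : ℝ) : ℂ) * I := by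
    rw [Complex.cos_add_mul_I]; push_cast; ring
  have hs := Real.sin_sq_add_cos_sq u
  have hc := Real.cosh_sq v
  have e : Real.cosh (2 * v) + Real.cos (2 * u) =
      2 * ((Real.cos u * Real.cosh v) ^ 2 + (Real.sin u * Real.sinh v) ^ 2) := by
    rw [Real.cosh_two_mul, Real.cos_two_mul]
    rw [mul_pow, mul_pow, hc,
      show Real.sin u ^ 2 = 1 - Real.cos u ^ 2 by linarith]
    ring
  rw [e, Complex.tan, h1, h2, Complex.div_im, Complex.normSq_add_mul_I, Real.sinh_two_mul]
  simp only [Complex.add_re, Complex.add_im, Complex.ofReal_re, Complex.ofReal_im,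
    Complex.re_ofReal_mul, Complex.im_ofReal_mul, Complex.I_re, Complex.I_im]
  rw [neg_sq, ← sub_div, mul_assoc 2 (Real.sinh v), mul_div_mul_left _ _ two_ne_zero]
  congr 1
  linear_combination Real.sinh v * Real.cosh v * hs

lemma norm_inv_sub_add_inv_neg_sub_le {c₀ c l x : ℝ} (hc₀ : Real.log 2 < c₀) (hc : c₀ ≤ c)
    (hx : x ∈ Ioo 0 (π / 2)) (hl : l = Real.log (2 * Real.cos x)) :
    Real.sin (2 * x) * ‖((c : ℂ) - (l + x * I))⁻¹ + (-(c : ℂ) - (l + x * I))⁻¹‖ ≤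
      8 * Real.exp 2 * (1 + 6 / min ((c₀ - Real.log 2) ^ 2) 1) * (1 / c ^ 2) := by
  have hcpos : 0 < c := ((Real.log_pos one_lt_two).trans hc₀).trans_le hc
  have hcos : 0 < Real.cos x := Real.cos_pos_of_mem_Ioo ⟨by linarith [hx.1, pi_pos], hx.2⟩
  have hcos1 := Real.cos_le_one x
  set m := min ((c₀ - Real.log 2) ^ 2) 1 with hm
  have hm0 : 0 < m := lt_min (by nlinarith) one_pos
  set w : ℂ := l + x * I with hw
  have hwre : w.re = l := by simp [hw]
  have hwim : w.im = x := by simp [hw]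
  have hle : m ≤ ‖(c : ℂ) - w‖ * ‖(c : ℂ) + w‖ := by
    rcases le_total 1 x with h1 | h1
    · have a1 := Complex.abs_im_le_norm ((c : ℂ) - w)
      have a2 := Complex.abs_im_le_norm ((c : ℂ) + w)
      simp only [Complex.sub_im, Complex.add_im, Complex.ofReal_im, hwim, zero_sub, zero_add,
        abs_neg, abs_of_pos hx.1] at a1 a2
      calc m ≤ 1 := min_le_right _ _
        _ ≤ _ := one_le_mul_of_one_le_of_one_le (h1.trans a1) (h1.trans a2)
    · have a1 := Complex.re_le_norm ((c : ℂ) - w)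
      have a2 := Complex.re_le_norm ((c : ℂ) + w)
      simp only [Complex.sub_re, Complex.add_re, Complex.ofReal_re, hwre] at a1 a2
      have l0 : 0 ≤ l := by
        rw [hl]
        apply Real.log_nonneg
        have := Real.one_sub_sq_div_two_le_cos (x := x)
        nlinarith [hx.1]
      have l1 : l ≤ Real.log 2 := by
        rw [hl]; exact Real.log_le_log (by positivity) (by linarith)
      have := Real.log_pos one_lt_two
      calc m ≤ (c₀ - Real.log 2) ^ 2 := min_le_left _ _
        _ = (c₀ - Real.log 2) * (c₀ - Real.log 2) := sq _
        _ ≤ _ := by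
          apply mul_le_mul <;> linarith
  have hpos : 0 < ‖(c : ℂ) - w‖ * ‖(c : ℂ) + w‖ := hm0.trans_le hle
  have n1 : (c : ℂ) - w ≠ 0 := by
    intro h; rw [h] at hpos; simp at hpos
  have n2 : (c : ℂ) + w ≠ 0 := by
    intro h; rw [h] at hpos; simp at hpos
  have n3 : (c : ℂ) ≠ 0 := by exact_mod_cast hcpos.ne'
  have id1 : ((c : ℂ) - w)⁻¹ + (-(c : ℂ) - w)⁻¹ =
      2 * w * (1 + w ^ 2 / (((c : ℂ) - w) * (c + w))) * (1 / (c : ℂ) ^ 2) := by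
    rw [show -(c : ℂ) - w = -(c + w) by ring, inv_neg]
    field_simp
    ring
  have b1 : ‖((c : ℂ) - w)⁻¹ + (-(c : ℂ) - w)⁻¹‖ ≤
      2 * ‖w‖ * (1 + ‖w‖ ^ 2 / m) * (1 / c ^ 2) := by
    rw [id1]
    simp only [norm_mul, norm_div, norm_pow, norm_one, Complex.norm_real, Complex.norm_ofNat,
      Real.norm_eq_abs, sq_abs]
    gcongr
    refine (norm_add_le _ _).trans ?_
    rw [norm_one, norm_div, norm_pow, norm_mul]
    gcongr
  have hwn : ‖w‖ ≤ |l| + 2 := by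
    refine (Complex.norm_le_abs_re_add_abs_im w).trans ?_
    rw [hwre, hwim, abs_of_pos hx.1]
    linarith [hx.2, pi_le_four]
  have e1 : ‖w‖ ≤ Real.exp ‖w‖ := by linarith [Real.add_one_le_exp ‖w‖]
  have e3 : ‖w‖ ^ 3 ≤ 6 * Real.exp ‖w‖ := by
    have := Real.pow_div_factorial_le_exp ‖w‖ (norm_nonneg w) 3
    norm_num [Nat.factorial] at this
    linarith
  have e4 : Real.exp ‖w‖ ≤ Real.exp |l| * Real.exp 2 := by
    rw [← Real.exp_add]; exact Real.exp_le_exp.2 hwn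
  have e5 : Real.cos x * Real.exp |l| ≤ 2 := by
    rcases abs_choice l with h | h <;> rw [h, hl]
    · rw [Real.exp_log (by positivity)]; nlinarith
    · rw [Real.exp_neg, Real.exp_log (by positivity)]
      field_simp
      norm_num
  have hsin : Real.sin (2 * x) ≤ 2 * Real.cos x := by
    rw [Real.sin_two_mul]; nlinarith [Real.sin_le_one x]
  calc Real.sin (2 * x) * ‖((c : ℂ) - w)⁻¹ + (-(c : ℂ) - w)⁻¹‖
      ≤ (2 * Real.cos x) * (2 * ‖w‖ * (1 + ‖w‖ ^ 2 / m) * (1 / c ^ 2)) := by gcongr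
    _ = 4 * Real.cos x * (‖w‖ + ‖w‖ ^ 3 / m) * (1 / c ^ 2) := by ring
    _ ≤ 4 * Real.cos x * (Real.exp ‖w‖ + 6 * Real.exp ‖w‖ / m) * (1 / c ^ 2) := by gcongr
    _ = 4 * Real.cos x * Real.exp ‖w‖ * (1 + 6 / m) * (1 / c ^ 2) := by ring
    _ ≤ 4 * Real.cos x * (Real.exp |l| * Real.exp 2) * (1 + 6 / m) * (1 / c ^ 2) := by gcongr
    _ = 4 * (Real.cos x * Real.exp |l|) * Real.exp 2 * (1 + 6 / m) * (1 / c ^ 2) := by ring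
    _ ≤ 4 * 2 * Real.exp 2 * (1 + 6 / m) * (1 / c ^ 2) := by gcongr
    _ = _ := by ring

lemma hasSum_one_div_odd_sq :
    HasSum (fun n : ℕ => 1 / (2 * (n : ℝ) + 1) ^ 2) (π ^ 2 / 8) := by
  have he : HasSum (fun n : ℕ => (1 : ℝ) / ((2 * n : ℕ) : ℝ) ^ 2) (1 / 4 * (π ^ 2 / 6)) := by
    convert! hasSum_zeta_two.mul_left (1 / 4) using 2 with n
    push_cast
    rw [mul_pow, one_div, one_div, mul_inv]; norm_num
  have ho : Summable (fun n : ℕ => (1 : ℝ) / ((2 * n + 1 : ℕ) : ℝ) ^ 2) :=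
    hasSum_zeta_two.summable.comp_injective (i := fun n : ℕ => 2 * n + 1)
      (fun a b h => by simpa using h)
  have := (he.even_add_odd (f := fun n : ℕ => (1 : ℝ) / (n : ℝ) ^ 2) ho.hasSum).unique
    hasSum_zeta_two
  rw [show π ^ 2 / 8 = ∑' n : ℕ, (1 : ℝ) / ((2 * n + 1 : ℕ) : ℝ) ^ 2 by linarith]
  convert! ho.hasSum using 2 with n
  push_cast; rfl

lemma hasSum_exp_neg_odd_mul {b : ℝ} (hb : 0 < b) :
    HasSum (fun n : ℕ => Real.exp (-((2 * n + 1) * b))) (1 / (2 * Real.sinh b)) := by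
  have hr : Real.exp (-(2 * b)) < 1 := Real.exp_lt_one_iff.2 (by linarith)
  have := (hasSum_geometric_of_lt_one (Real.exp_pos _).le hr).mul_left (Real.exp (-b))
  convert! this using 1
  · ext n
    rw [← Real.exp_nat_mul, ← Real.exp_add]
    congr 1; ring
  · rw [Real.sinh_eq, show -(2 * b) = -b + -b by ring, Real.exp_add, Real.exp_neg]
    have h1 : 1 < Real.exp b := Real.one_lt_exp_iff.2 hb
    set t := Real.exp b
    have ht : t ≠ 0 := by linarith
    have h2 : t ^ 2 - 1 ≠ 0 := by nlinarith
    have e1 : t - t⁻¹ = (t ^ 2 - 1) / t := by field_simp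
    have e2 : 1 - t⁻¹ * t⁻¹ = (t ^ 2 - 1) / t ^ 2 := by field_simp
    rw [e1, e2]
    field_simp

theorem stmt_10 (α : ℝ) (hα : Real.log 2 / π < α) :
    ∫ x in (0:ℝ)..(π/2),
        (Real.sin (2*x) * Real.sinh (x/α))
          / (Real.cosh (x/α) + Real.cos (Real.log (2 * Real.cos x) / α))
      = π / (8*α) + π*α / (4 * Real.sinh (π*α))
        - (π*α/8) * ∑' n : ℕ, 1 / (Real.sinh (π*α*(2*n+1)/2))^2 := by
  have hlog := Real.log_pos one_lt_two
  have hα0 : 0 < α := (div_pos hlog pi_pos).trans hα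
  have hb : Real.log 2 < π * α := by rwa [div_lt_iff₀' pi_pos] at hα
  have hb0 : 0 < π * α := by positivity
  set c : ℕ → ℝ := fun n => (2 * n + 1) * (π * α) with hc
  have hcb : ∀ n, π * α ≤ c n := fun n => by
    have : (0 : ℝ) ≤ n := n.cast_nonneg
    simp only [hc]; nlinarith
  have hc2 : ∀ n, Real.log 2 < c n := fun n => hb.trans_le (hcb n)
  have hc0 : ∀ n, 0 < c n := fun n => hlog.trans (hc2 n)
  have hsumc : HasSum (fun n => 1 / c n ^ 2) (1 / (8 * α ^ 2)) := by
    convert! hasSum_one_div_odd_sq.mul_left (1 / (π * α) ^ 2) using 1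
    · ext n
      simp only [hc]
      have : (2 * (n : ℝ) + 1) ≠ 0 := by positivity
      field_simp
    · field_simp
  set F : ℕ → ℝ → ℝ := fun n x => 2 * α * (Real.sin (2 * x) *
      (invSubLog (c n) (Complex.exp (2 * x * I)) +
        invSubLog (-c n) (Complex.exp (2 * x * I))).im) with hF
  set M : ℝ := 2 * α * (8 * Real.exp 2 * (1 + 6 / min ((π * α - Real.log 2) ^ 2) 1)) with hM
  have hM0 : 0 ≤ M := by positivity
  have hval : ∀ x ∈ Ioo 0 (π / 2), ∀ n, F n x = 2 * α * (Real.sin (2 * x) *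
      (((c n : ℂ) - (Real.log (2 * Real.cos x) + x * I))⁻¹ +
        (-(c n : ℂ) - (Real.log (2 * Real.cos x) + x * I))⁻¹).im) := by
    intro x hx n
    have hne : Complex.exp (2 * x * I) ≠ -1 := by
      intro h
      have := congrArg Complex.re h
      rw [show (2 : ℂ) * x * I = ((2 * x : ℝ) : ℂ) * I by push_cast; ring,
        Complex.exp_ofReal_mul_I_re, Real.cos_two_mul] at this
      have hcos : 0 < Real.cos x := Real.cos_pos_of_mem_Ioo ⟨by linarith [hx.1, pi_pos], hx.2⟩
      simp at this
      nlinarith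
    simp only [hF]
    rw [invSubLog_of_ne _ hne, invSubLog_of_ne _ hne,
      log_one_add_exp_two_mul_I ⟨by linarith [hx.1, pi_pos], hx.2⟩]
    push_cast
    rfl
  have hcases : ∀ x ∈ uIoc (0 : ℝ) (π / 2), x ∈ Ioo 0 (π / 2) ∨ x = π / 2 := by
    intro x hx
    rw [uIoc_of_le (by positivity)] at hx
    rcases hx.2.lt_or_eq with h | h
    · exact Or.inl ⟨hx.1, h⟩
    · exact Or.inr h
  have hDCT := intervalIntegral.hasSum_integral_of_dominated_convergence (μ := volume)
    (a := 0) (b := π / 2) (F := F)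
    (f := fun x => (Real.sin (2*x) * Real.sinh (x/α))
          / (Real.cosh (x/α) + Real.cos (Real.log (2 * Real.cos x) / α)))
    (fun n _ => M * (1 / c n ^ 2)) ?_ ?_ ?_ ?_ ?_
  rotate_left
  · intro n
    have hk : ∀ d : ℝ, (Real.log 2 < d ∨ d < 0) →
        Continuous fun x : ℝ => invSubLog d (Complex.exp (2 * x * I)) := fun d hd =>
      (continuousOn_invSubLog_sphere hd).comp_continuous (by fun_prop) (fun x => by
        have := Complex.norm_exp_ofReal_mul_I (2 * x)
        push_cast at this
        simpa using this)
    have h1 := hk (c n) (Or.inl (hc2 n))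
    have h2 := hk (-c n) (Or.inr (by linarith [hc0 n]))
    have : Continuous (F n) := by
      have := Complex.continuous_im.comp (h1.add h2)
      exact continuous_const.mul (Continuous.mul (by fun_prop) this)
    exact this.aestronglyMeasurable
  · intro n
    refine Eventually.of_forall fun x hx => ?_
    rcases hcases x hx with hx | rfl
    · have hs : 0 ≤ Real.sin (2 * x) :=
        Real.sin_nonneg_of_nonneg_of_le_pi (by linarith [hx.1]) (by linarith [hx.2])
      have := norm_inv_sub_add_inv_neg_sub_le hb (hcb n) hx rfl
      rw [hval x hx n, Real.norm_eq_abs, abs_mul, abs_of_pos (show 0 < 2 * α by positivity),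
        abs_mul, abs_of_nonneg hs, hM, mul_assoc (2 * α)]
      refine mul_le_mul_of_nonneg_left (le_trans ?_ this) (by positivity)
      exact mul_le_mul_of_nonneg_left (Complex.abs_im_le_norm _) hs
    · have : F n (π / 2) = 0 := by
        simp only [hF]
        rw [mul_div_cancel₀ π two_ne_zero, Real.sin_pi]; ring
      rw [this, norm_zero]
      positivity
  · exact Eventually.of_forall fun x _ => hsumc.summable.mul_left M
  · exact intervalIntegrable_const
  · refine Eventually.of_forall fun x hx => ?_
    rcases hcases x hx with hx | rfl
    · set l := Real.log (2 * Real.cos x) with hl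
      set y : ℂ := ((l : ℂ) + x * I) / (π * α) with hy
      have hyim : y.im ≠ 0 := by
        rw [hy, ← Complex.ofReal_mul, Complex.div_ofReal_im]
        simp [hx.1.ne', hb0.ne']
      have h1 := ((Complex.imCLM.hasSum (hasSum_tan hyim)).mul_left
        (2 / π * Real.sin (2 * x)))
      have hpi : (π : ℂ) ≠ 0 := by exact_mod_cast pi_ne_zero
      have hα' : (α : ℂ) ≠ 0 := by exact_mod_cast hα0.ne'
      have harg : (π : ℂ) * y / 2 = ((l / (2 * α) : ℝ) : ℂ) + ((x / (2 * α) : ℝ) : ℂ) * I := by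
        rw [hy]; push_cast; field_simp
      convert! h1 using 1
      · ext n
        rw [hval x hx n, ← hl]
        have e : ((2 * n + 1 : ℂ) - y)⁻¹ + (-(2 * n + 1 : ℂ) - y)⁻¹ = ((π * α : ℝ) : ℂ) *
            (((c n : ℂ) - (l + x * I))⁻¹ + (-(c n : ℂ) - (l + x * I))⁻¹) := by
          rw [show (2 * n + 1 : ℂ) - y = ((c n : ℂ) - (l + x * I)) / (π * α) by
            rw [hy]; simp only [hc]; push_cast; field_simp,
            show -(2 * n + 1 : ℂ) - y = (-(c n : ℂ) - (l + x * I)) / (π * α) by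
            rw [hy]; simp only [hc]; push_cast; field_simp]
          rw [inv_div, inv_div]
          push_cast
          ring
        simp only [Complex.imCLM_apply]
        rw [e, Complex.im_ofReal_mul]
        field_simp
      · simp only [Complex.imCLM_apply]
        rw [harg, show (π : ℂ) / 2 = ((π / 2 : ℝ) : ℂ) by push_cast; ring,
          Complex.im_ofReal_mul, im_tan_eq]
        rw [show 2 * (x / (2 * α)) = x / α by field_simp,
          show 2 * (l / (2 * α)) = l / α by field_simp]
        field_simp
    · have : Real.sin (2 * (π / 2)) = 0 := by
        rw [mul_div_cancel₀ π two_ne_zero, Real.sin_pi]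
      simp only [hF, this, zero_mul, mul_zero, zero_div]
      exact hasSum_zero
  have hint : ∀ n, ∫ x in (0 : ℝ)..(π / 2), F n x = π * α / 2 *
      (2 / c n ^ 2 + Real.exp (-c n) - 1 / (4 * Real.sinh (c n / 2) ^ 2)) := by
    intro n
    simp only [hF]
    rw [intervalIntegral.integral_const_mul, integral_sin_mul_invSubLog (hc2 n)]
    ring
  simp only [hint] at hDCT
  have hexp : HasSum (fun n => Real.exp (-c n)) (1 / (2 * Real.sinh (π * α))) :=
    hasSum_exp_neg_odd_mul hb0
  have h4 := ((((hsumc.mul_left 2).add hexp).mul_left (π * α / 2)).sub hDCT).mul_left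
    (8 / (π * α))
  have hterm : ∀ n : ℕ, 1 / (Real.sinh (π*α*(2*n+1)/2))^2 = 8 / (π * α) *
      (π * α / 2 * (2 * (1 / c n ^ 2) + Real.exp (-c n)) - π * α / 2 *
        (2 / c n ^ 2 + Real.exp (-c n) - 1 / (4 * Real.sinh (c n / 2) ^ 2))) := by
    intro n
    rw [show π * α * (2 * n + 1) / 2 = c n / 2 by simp only [hc]; ring]
    field_simp
    ring
  rw [tsum_congr hterm, h4.tsum_eq]
  have : Real.sinh (π * α) ≠ 0 := (Real.sinh_pos_iff.2 hb0).ne'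
  field_simp
  ring
end

section
/- For every α > (ln 2)/(2π), ∫_0^{π/2} (cos 2x · sin(ln(2 cos x)/α)) / (cosh(x/α) - cos(ln(2 cos x)/α)) dx = 11πα/24 - π/(24α) + πα/(2(e^{2πα} - 1)) + (πα/8)·Σ_{n=1}^∞ 1/sinh²(παn). -/
open Real

open Metric Filter Topology MeasureTheory

/-- The function `z ↦ 1 / (log (1 + z) - c)`, with its limit value `0` at `z = -1`. -/
noncomputable def invLogSub (c : ℝ) (z : ℂ) : ℂ :=
  if z = -1 then 0 else (Complex.log (1 + z) - c)⁻¹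

lemma one_add_mem_slitPlane_of_mem_closedBall {z : ℂ} (hz : z ∈ closedBall (0 : ℂ) 1)
    (h1 : z ≠ -1) : 1 + z ∈ Complex.slitPlane := by
  rw [mem_closedBall_zero_iff] at hz
  have hsq : z.re ^ 2 + z.im ^ 2 ≤ 1 := by
    have h2 := Complex.sq_norm z
    rw [Complex.normSq_apply] at h2
    nlinarith [norm_nonneg z]
  rw [Complex.mem_slitPlane_iff]
  by_contra! h
  simp only [Complex.add_re, Complex.one_re, Complex.add_im, Complex.one_im, zero_add] at h
  apply h1
  have him : z.im = 0 := h.2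
  apply Complex.ext <;> simp [him]
  nlinarith [h.1]

lemma log_one_add_sub_ne_zero {c : ℝ} {z : ℂ} (h0 : 1 + z ≠ 0) (hz : z ≠ rexp c - 1) :
    Complex.log (1 + z) - c ≠ 0 := by
  intro h
  apply hz
  have := Complex.exp_log h0
  rw [sub_eq_zero.1 h] at this
  push_cast
  linear_combination -this

lemma differentiableAt_invLogSub {c : ℝ} {z : ℂ} (h : 1 + z ∈ Complex.slitPlane)
    (hz : z ≠ rexp c - 1) : DifferentiableAt ℂ (invLogSub c) z := by
  have h0 : 1 + z ≠ 0 := Complex.slitPlane_ne_zero h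
  have h1 : z ≠ -1 := fun h' ↦ h0 (by simp [h'])
  have hd : DifferentiableAt ℂ (fun z : ℂ ↦ (Complex.log (1 + z) - c)⁻¹) z :=
    ((((differentiableAt_id.const_add 1).clog h)).sub_const _).inv
      (log_one_add_sub_ne_zero h0 hz)
  refine hd.congr_of_eventuallyEq ?_
  filter_upwards [isOpen_ne.mem_nhds h1] with w hw
  exact if_neg hw

lemma continuousAt_invLogSub_neg_one (c : ℝ) : ContinuousAt (invLogSub c) (-1) := by
  rw [continuousAt_iff_punctured_nhds]
  have hval : invLogSub c (-1) = 0 := if_pos rfl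
  rw [hval]
  have hshift : Tendsto (fun z : ℂ ↦ ‖1 + z‖) (𝓝[≠] (-1)) (𝓝[≠] 0) := by
    refine tendsto_nhdsWithin_iff.2 ⟨?_, ?_⟩
    · have : ContinuousAt (fun z : ℂ ↦ ‖1 + z‖) (-1) := by fun_prop
      simpa [ContinuousAt] using this.tendsto.mono_left nhdsWithin_le_nhds
    · filter_upwards [self_mem_nhdsWithin] with z hz
      simp only [Set.mem_compl_iff, Set.mem_singleton_iff, norm_eq_zero]
      intro h
      exact hz (by simp only [Set.mem_singleton_iff]; linear_combination h)
  have hre : Tendsto (fun z : ℂ ↦ |Real.log ‖1 + z‖| - |c|) (𝓝[≠] (-1)) atTop :=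
    tendsto_atTop_add_const_right _ _
      (tendsto_abs_atBot_atTop.comp (Real.tendsto_log_nhdsNE_zero.comp hshift))
  have hlog : Tendsto (fun z : ℂ ↦ ‖Complex.log (1 + z) - c‖) (𝓝[≠] (-1)) atTop := by
    refine tendsto_atTop_mono (fun z ↦ ?_) hre
    calc |Real.log ‖1 + z‖| - |c| ≤ ‖Complex.log (1 + z)‖ - ‖(c : ℂ)‖ := by
          have := Complex.abs_re_le_norm (Complex.log (1 + z))
          rw [Complex.log_re] at this
          simpa using this
      _ ≤ _ := norm_sub_norm_le _ _
  have hinv := tendsto_inv₀_cobounded.comp (tendsto_norm_atTop_iff_cobounded.1 hlog)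
  refine hinv.congr' ?_
  filter_upwards [self_mem_nhdsWithin] with z hz
  exact (if_neg hz).symm

lemma continuousAt_invLogSub {c : ℝ} {z : ℂ} (hz : z ∈ closedBall (0 : ℂ) 1)
    (hc : z ≠ rexp c - 1) : ContinuousAt (invLogSub c) z := by
  by_cases h1 : z = -1
  · rw [h1]
    exact continuousAt_invLogSub_neg_one c
  · exact (differentiableAt_invLogSub (one_add_mem_slitPlane_of_mem_closedBall hz h1)
      hc).continuousAt

lemma one_add_mem_slitPlane_of_mem_ball {z : ℂ} (hz : z ∈ ball (0 : ℂ) 1) :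
    1 + z ∈ Complex.slitPlane :=
  one_add_mem_slitPlane_of_mem_closedBall (ball_subset_closedBall hz) fun h ↦ by
    simp [h] at hz

lemma ne_exp_sub_one_of_mem_closedBall {c : ℝ} (hc : Real.log 2 < c) {z : ℂ}
    (hz : z ∈ closedBall (0 : ℂ) 1) : z ≠ rexp c - 1 := by
  rintro rfl
  rw [mem_closedBall_zero_iff] at hz
  have h2 : 2 < rexp c := (Real.log_lt_iff_lt_exp two_pos).1 hc
  have := (Complex.re_le_norm _).trans hz
  norm_num [← Complex.ofReal_exp] at this
  linarith

lemma exp_sub_one_mem_ball {c : ℝ} (hc : c < Real.log 2) : (rexp c - 1 : ℂ) ∈ ball (0 : ℂ) 1 := by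
  have h2 : rexp c < 2 := (Real.lt_log_iff_exp_lt two_pos).1 hc
  have h0 := Real.exp_pos c
  rw [mem_ball_zero_iff]
  have : ((rexp c : ℂ) - 1) = ((rexp c - 1 : ℝ) : ℂ) := by push_cast; rfl
  rw [this, Complex.norm_real, Real.norm_eq_abs, abs_lt]
  constructor <;> linarith

/-- The residue of `z⁻² r(z)` at the centre of the disc. -/
lemma circleIntegral_zpow_neg_two_mul {r : ℂ → ℂ} {r' : ℂ} {s : Set ℂ} (hs : s.Countable)
    (hc : ContinuousOn r (closedBall 0 1)) (hd : ∀ z ∈ ball (0 : ℂ) 1 \ s, DifferentiableAt ℂ r z)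
    (h0 : HasDerivAt r r' 0) :
    (∮ z in C(0, 1), z ^ (-2 : ℤ) * r z) = 2 * π * Complex.I * r' := by
  have hslope : (∮ z in C(0, 1), (z - 0)⁻¹ • slope r 0 z) = (2 * π * Complex.I : ℂ) • r' := by
    refine Complex.circleIntegral_sub_center_inv_smul_of_differentiable_on_off_countable_of_tendsto
      one_pos hs ?_ ?_ (hasDerivAt_iff_tendsto_slope.1 h0)
    · have : ContinuousOn (fun z ↦ (z - 0)⁻¹ • (r z - r 0)) (closedBall (0 : ℂ) 1 \ {0}) := by
        refine ContinuousOn.smul (ContinuousOn.inv₀ (continuousOn_id.sub continuousOn_const) ?_)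
          ((hc.mono Set.sdiff_subset).sub continuousOn_const)
        rintro z ⟨-, hz⟩
        simpa using hz
      exact this
    · rintro z ⟨⟨hz, hz0⟩, hzs⟩
      have : DifferentiableAt ℂ (fun z ↦ (z - 0)⁻¹ • (r z - r 0)) z :=
        DifferentiableAt.smul ((differentiableAt_id.sub_const 0).inv (by simpa using hz0))
          ((hd z ⟨hz, hzs⟩).sub_const _)
      exact this
  have hsph : ∀ z ∈ sphere (0 : ℂ) 1, z ≠ 0 := fun z hz h ↦ by simp [h] at hz
  have hzc : ∀ m : ℤ, ContinuousOn (fun z : ℂ ↦ z ^ m) (sphere 0 1) := fun m z hz ↦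
    (continuousAt_zpow₀ z m (Or.inl (hsph z hz))).continuousWithinAt
  have hrs := hc.mono sphere_subset_closedBall
  have hconst : (∮ z in C(0, 1), r 0 * z ^ (-2 : ℤ)) = 0 := by
    have := circleIntegral.integral_sub_zpow_of_ne (n := -2) (by norm_num) 0 0 1
    simp only [sub_zero] at this
    rw [circleIntegral.integral_const_mul, this, mul_zero]
  have heq : (∮ z in C(0, 1), z ^ (-2 : ℤ) * r z) =
      ∮ z in C(0, 1), ((z - 0)⁻¹ • slope r 0 z + r 0 * z ^ (-2 : ℤ)) := by
    refine circleIntegral.integral_congr zero_le_one fun z hz ↦ ?_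
    have := hsph z hz
    simp only [slope, vsub_eq_sub, smul_eq_mul, sub_zero]
    rw [show (-2 : ℤ) = -(2 : ℕ) by norm_num, zpow_neg, zpow_natCast]
    field_simp
    ring
  rw [heq, circleIntegral.integral_add, hslope, hconst, add_zero, smul_eq_mul]
  · refine ContinuousOn.circleIntegrable zero_le_one ?_
    have : ContinuousOn (fun z ↦ (z - 0)⁻¹ • ((z - 0)⁻¹ • (r z - r 0))) (sphere (0 : ℂ) 1) := by
      have hi : ContinuousOn (fun z : ℂ ↦ (z - 0)⁻¹) (sphere (0 : ℂ) 1) :=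
        ContinuousOn.inv₀ (by fun_prop) fun z hz ↦ by simpa using hsph z hz
      exact hi.smul (hi.smul (hrs.sub continuousOn_const))
    exact this
  · exact ((continuousOn_const).mul (hzc _)).circleIntegrable zero_le_one

lemma ne_zero_of_mem_unitSphere {z : ℂ} (hz : z ∈ sphere (0 : ℂ) 1) : z ≠ 0 := fun h ↦ by
  simp [h] at hz

lemma continuousOn_zpow_unitSphere (m : ℤ) :
    ContinuousOn (fun z : ℂ ↦ z ^ m) (sphere 0 1) := fun z hz ↦
  (continuousAt_zpow₀ z m (Or.inl (ne_zero_of_mem_unitSphere hz))).continuousWithinAt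

lemma hasDerivAt_invLogSub_zero {c : ℝ} (hc : c ≠ 0) :
    HasDerivAt (invLogSub c) (-((c : ℂ) ^ 2)⁻¹) 0 := by
  have hc' : (c : ℂ) ≠ 0 := by exact_mod_cast hc
  have h1 : HasDerivAt (fun z : ℂ ↦ (Complex.log (1 + z) - c)⁻¹) (-((c : ℂ) ^ 2)⁻¹) 0 := by
    have hl : HasDerivAt (fun z : ℂ ↦ Complex.log (1 + z) - c) 1 0 := by
      have := (((hasDerivAt_id (0 : ℂ)).const_add 1).clog (by simp)).sub_const (c : ℂ)
      simpa using this
    have := hl.fun_inv (by simpa using hc')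
    simpa [neg_div] using this
  refine h1.congr_of_eventuallyEq ?_
  filter_upwards [isOpen_ne.mem_nhds (show (0 : ℂ) ≠ -1 by norm_num)] with w hw
  exact if_neg hw

lemma circleIntegral_invLogSub_of_log_two_lt {c : ℝ} (hc : Real.log 2 < c) :
    (∮ z in C(0, 1), (1 + z ^ (-2 : ℤ)) * invLogSub c z) =
      2 * π * Complex.I * (-((c : ℂ) ^ 2)⁻¹) := by
  have hc0 : c ≠ 0 := ((Real.log_pos one_lt_two).trans hc).ne'
  have hcont : ContinuousOn (invLogSub c) (closedBall 0 1) := fun z hz ↦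
    (continuousAt_invLogSub hz (ne_exp_sub_one_of_mem_closedBall hc hz)).continuousWithinAt
  have hdiff : ∀ z ∈ ball (0 : ℂ) 1 \ ∅, DifferentiableAt ℂ (invLogSub c) z := fun z hz ↦
    differentiableAt_invLogSub (one_add_mem_slitPlane_of_mem_ball hz.1)
      (ne_exp_sub_one_of_mem_closedBall hc (ball_subset_closedBall hz.1))
  have hsph := hcont.mono sphere_subset_closedBall
  have hzsph : CircleIntegrable (fun z ↦ z ^ (-2 : ℤ) * invLogSub c z) 0 1 :=
    ((continuousOn_zpow_unitSphere _).mul hsph).circleIntegrable zero_le_one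
  simp only [add_mul, one_mul]
  rw [circleIntegral.integral_add (hsph.circleIntegrable zero_le_one)
      hzsph,
    Complex.circleIntegral_eq_zero_of_differentiable_on_off_countable zero_le_one
      Set.countable_empty hcont hdiff,
    circleIntegral_zpow_neg_two_mul Set.countable_empty hcont hdiff
      (hasDerivAt_invLogSub_zero hc0), zero_add]

lemma hasDerivAt_log_one_add_exp_sub_one (c : ℝ) :
    HasDerivAt (fun z : ℂ ↦ Complex.log (1 + z)) (rexp c : ℂ)⁻¹ (rexp c - 1) := by
  have hs : (1 + (rexp c - 1) : ℂ) ∈ Complex.slitPlane := by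
    rw [add_sub_cancel]
    exact Complex.ofReal_mem_slitPlane.2 (Real.exp_pos c)
  simpa using ((hasDerivAt_id (rexp c - 1 : ℂ)).const_add 1).clog hs

/-- The function `(z - p) / (log (1 + z) - c)`, where `p = exp c - 1`, extended to `z = p`. -/
noncomputable def mulInvLogSub (c : ℝ) : ℂ → ℂ :=
  Function.update (fun z ↦ (z - (rexp c - 1)) * invLogSub c z) (rexp c - 1) (rexp c)

lemma mulInvLogSub_of_ne {c : ℝ} {z : ℂ} (hz : z ≠ rexp c - 1) :
    mulInvLogSub c z = (z - (rexp c - 1)) * invLogSub c z :=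
  Function.update_of_ne hz _ _

lemma mulInvLogSub_eventuallyEq {c : ℝ} {z : ℂ} (hz : z ≠ rexp c - 1) :
    mulInvLogSub c =ᶠ[𝓝 z] fun z ↦ (z - (rexp c - 1)) * invLogSub c z := by
  filter_upwards [isOpen_ne.mem_nhds hz] with w hw
  exact mulInvLogSub_of_ne hw

lemma continuousAt_mulInvLogSub (c : ℝ) : ContinuousAt (mulInvLogSub c) (rexp c - 1) := by
  rw [mulInvLogSub, continuousAt_update_same]
  have h := (hasDerivAt_iff_tendsto_slope.1 (hasDerivAt_log_one_add_exp_sub_one c)).inv₀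
    (inv_ne_zero (by exact_mod_cast (Real.exp_pos c).ne'))
  rw [inv_inv] at h
  refine h.congr' ?_
  have hp : (rexp c - 1 : ℂ) ≠ -1 := fun h ↦ by
    have : (rexp c : ℂ) = 0 := by linear_combination h
    exact (Real.exp_pos c).ne' (by exact_mod_cast this)
  filter_upwards [nhdsWithin_le_nhds (isOpen_ne.mem_nhds hp)] with w hw
  rw [invLogSub, if_neg hw, slope, vsub_eq_sub, smul_eq_mul, mul_inv, inv_inv, add_sub_cancel,
    ← Complex.ofReal_log (Real.exp_pos c).le, Real.log_exp]

lemma continuousOn_mulInvLogSub (c : ℝ) :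
    ContinuousOn (mulInvLogSub c) (closedBall 0 1) := fun z hz ↦ by
  by_cases h : z = rexp c - 1
  · rw [h]
    exact (continuousAt_mulInvLogSub c).continuousWithinAt
  · have : ContinuousAt (fun z ↦ (z - (rexp c - 1)) * invLogSub c z) z :=
      ContinuousAt.mul (by fun_prop) (continuousAt_invLogSub hz h)
    exact (this.congr (mulInvLogSub_eventuallyEq h).symm).continuousWithinAt

lemma differentiableAt_mulInvLogSub {c : ℝ} {z : ℂ} (hz : z ∈ ball (0 : ℂ) 1)
    (h : z ≠ rexp c - 1) : DifferentiableAt ℂ (mulInvLogSub c) z := by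
  have : DifferentiableAt ℂ (fun z ↦ (z - (rexp c - 1)) * invLogSub c z) z :=
    DifferentiableAt.mul (by fun_prop)
      (differentiableAt_invLogSub (one_add_mem_slitPlane_of_mem_ball hz) h)
  exact this.congr_of_eventuallyEq (mulInvLogSub_eventuallyEq h)

lemma circleIntegral_invLogSub_of_neg {c : ℝ} (hc : c < 0) :
    (∮ z in C(0, 1), (1 + z ^ (-2 : ℤ)) * invLogSub c z) =
      2 * π * Complex.I * ((1 + ((rexp c - 1 : ℂ) ^ 2)⁻¹) * rexp c - ((c : ℂ) ^ 2)⁻¹) := by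
  set p : ℂ := rexp c - 1 with hp
  have hpb : p ∈ ball (0 : ℂ) 1 := exp_sub_one_mem_ball (hc.trans (Real.log_pos one_lt_two))
  have hp0 : p ≠ 0 := fun h ↦ by
    have : rexp c = 1 := by exact_mod_cast sub_eq_zero.1 h
    exact hc.ne (Real.exp_eq_one_iff c |>.1 this)
  have hsph : ∀ z ∈ sphere (0 : ℂ) 1, z ≠ p := by
    rintro z hz rfl
    rw [mem_ball_zero_iff] at hpb
    rw [mem_sphere_zero_iff_norm] at hz
    exact hpb.ne hz
  have hH := continuousOn_mulInvLogSub c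
  have hd : ∀ z ∈ ball (0 : ℂ) 1 \ {p}, DifferentiableAt ℂ (mulInvLogSub c) z := fun z hz ↦
    differentiableAt_mulInvLogSub hz.1 hz.2
  have hcauchy := Complex.circleIntegral_sub_inv_smul_of_differentiable_on_off_countable
    (Set.countable_singleton p) hpb hH hd
  have hHp : mulInvLogSub c p = rexp c := Function.update_self _ _ _
  rw [hHp] at hcauchy
  have hderiv : HasDerivAt (fun z ↦ ((p ^ 2)⁻¹ * z + p⁻¹) * mulInvLogSub c z)
      (((c : ℂ) ^ 2)⁻¹) 0 := by
    have h1 : HasDerivAt (fun z ↦ (z ^ 2 * (p ^ 2)⁻¹ - 1) * invLogSub c z)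
        (((c : ℂ) ^ 2)⁻¹) 0 := by
      have hq : HasDerivAt (fun z : ℂ ↦ z ^ 2 * (p ^ 2)⁻¹ - 1) 0 0 := by
        simpa using ((hasDerivAt_pow 2 (0 : ℂ)).mul_const ((p ^ 2)⁻¹)).sub_const 1
      simpa using hq.fun_mul (hasDerivAt_invLogSub_zero hc.ne)
    refine h1.congr_of_eventuallyEq ?_
    filter_upwards [mulInvLogSub_eventuallyEq hp0.symm] with z hz
    rw [hz, ← hp]
    field_simp
    ring
  have hcr : ContinuousOn (fun z ↦ ((p ^ 2)⁻¹ * z + p⁻¹) * mulInvLogSub c z) (closedBall 0 1) :=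
    ContinuousOn.mul (by fun_prop) hH
  have hres := circleIntegral_zpow_neg_two_mul (Set.countable_singleton p) hcr
    (fun z hz ↦ DifferentiableAt.mul (by fun_prop) (hd z hz)) hderiv
  have hsplit : (∮ z in C(0, 1), (1 + z ^ (-2 : ℤ)) * invLogSub c z) =
      ∮ z in C(0, 1), ((1 + (p ^ 2)⁻¹) * ((z - p)⁻¹ • mulInvLogSub c z) -
        z ^ (-2 : ℤ) * (((p ^ 2)⁻¹ * z + p⁻¹) * mulInvLogSub c z)) := by
    refine circleIntegral.integral_congr zero_le_one fun z hz ↦ ?_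
    have hz0 := ne_zero_of_mem_unitSphere hz
    have hzp := sub_ne_zero.2 (hsph z hz)
    rw [mulInvLogSub_of_ne (hsph z hz), ← hp,
      show (-2 : ℤ) = -(2 : ℕ) by norm_num, zpow_neg, zpow_natCast, smul_eq_mul]
    field_simp
    ring
  have hHs := hH.mono sphere_subset_closedBall
  rw [hsplit, circleIntegral.integral_sub, circleIntegral.integral_const_mul, hcauchy, hres,
    smul_eq_mul]
  · ring
  · refine ContinuousOn.circleIntegrable zero_le_one (continuousOn_const.mul (ContinuousOn.smul
      (ContinuousOn.inv₀ (by fun_prop) fun z hz ↦ sub_ne_zero.2 (hsph z hz)) hHs))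
  · exact ((continuousOn_zpow_unitSphere _).mul
      (hcr.mono sphere_subset_closedBall)).circleIntegrable zero_le_one

/-- The coefficient of `z` in the Laurent expansion `1 / log (1 + z) = 1/z + 1/2 - z/12 + ⋯`. -/
lemma tendsto_inv_log_one_add_sub :
    Tendsto (fun z : ℂ ↦ z⁻¹ * ((Complex.log (1 + z))⁻¹ - z⁻¹ - 2⁻¹)) (𝓝[≠] 0)
      (𝓝 (-12⁻¹)) := by
  have hO := Complex.log_sub_logTaylor_isBigO 3
  have hT : ∀ z, Complex.logTaylor (3 + 1) z = z - z ^ 2 / 2 + z ^ 3 / 3 := fun z ↦ by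
    simp [Complex.logTaylor, Finset.sum_range_succ]
    ring
  simp only [hT] at hO
  have hr : Tendsto (fun z : ℂ ↦ (Complex.log (1 + z) - (z - z ^ 2 / 2 + z ^ 3 / 3)) / z ^ 3)
      (𝓝[≠] 0) (𝓝 0) :=
    (((hO.trans_isLittleO (Asymptotics.isLittleO_pow_pow (by norm_num : 3 < 3 + 1))).mono
      nhdsWithin_le_nhds)).tendsto_div_nhds_zero
  have hl : Tendsto (fun z : ℂ ↦ Complex.log (1 + z) / z) (𝓝[≠] 0) (𝓝 1) := by
    have := hasDerivAt_iff_tendsto_slope.1 (hasDerivAt_log_one_add_exp_sub_one 0)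
    simp at this
    refine this.congr fun z ↦ ?_
    simp [slope, div_eq_inv_mul]
  have hz : Tendsto (fun z : ℂ ↦ z) (𝓝[≠] 0) (𝓝 0) := tendsto_id.mono_left nhdsWithin_le_nhds
  have hlim := ((((hz.div_const 3).const_sub (-6⁻¹)).sub ((hz.const_add 2).mul hr)).div_const 2).div
    hl one_ne_zero
  have hval : ((-6⁻¹ - 0 / 3 - (2 + 0) * 0) / 2 / 1 : ℂ) = -12⁻¹ := by norm_num
  rw [hval] at hlim
  refine hlim.congr' ?_
  filter_upwards [self_mem_nhdsWithin, hl.eventually_ne one_ne_zero] with z hz0 hl0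
  have h0 : z ≠ 0 := hz0
  have hl1 : Complex.log (1 + z) ≠ 0 := fun h ↦ hl0 (by simp [h])
  simp only [Pi.div_apply]
  field_simp
  ring

lemma circleIntegral_invLogSub_zero :
    (∮ z in C(0, 1), (1 + z ^ (-2 : ℤ)) * invLogSub 0 z) = 2 * π * Complex.I * (11 / 12) := by
  have hne : ∀ z : ℂ, z ≠ 0 → z ≠ rexp 0 - 1 := fun z hz ↦ by simpa using hz
  have hg : ContinuousOn (invLogSub 0) (closedBall 0 1 \ {0}) := fun z hz ↦
    (continuousAt_invLogSub hz.1 (hne z hz.2)).continuousWithinAt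
  have hinv : ContinuousOn (fun z : ℂ ↦ z⁻¹) (closedBall 0 1 \ {0}) :=
    continuousOn_id.inv₀ fun z hz ↦ hz.2
  have hcont : ContinuousOn (fun z : ℂ ↦ (z + z⁻¹) * (invLogSub 0 z - z⁻¹ - 2⁻¹))
      (closedBall 0 1 \ {0}) :=
    (continuousOn_id.add hinv).mul ((hg.sub hinv).sub continuousOn_const)
  have hlim : Tendsto (fun z : ℂ ↦ (z + z⁻¹) * (invLogSub 0 z - z⁻¹ - 2⁻¹)) (𝓝[≠] 0)
      (𝓝 (-12⁻¹)) := by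
    have hz : Tendsto (fun z : ℂ ↦ z ^ 2 + 1) (𝓝[≠] 0) (𝓝 (0 ^ 2 + 1)) :=
      ((continuous_pow 2).add continuous_const).continuousAt.tendsto.mono_left nhdsWithin_le_nhds
    have := hz.mul tendsto_inv_log_one_add_sub
    rw [show ((0 : ℂ) ^ 2 + 1) * -12⁻¹ = -12⁻¹ by norm_num] at this
    refine this.congr' ?_
    filter_upwards [self_mem_nhdsWithin,
      nhdsWithin_le_nhds (isOpen_ne.mem_nhds (show (0 : ℂ) ≠ -1 by norm_num))] with z hz0 hz1
    have h0 : z ≠ 0 := hz0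
    rw [invLogSub, if_neg hz1, Complex.ofReal_zero, sub_zero]
    field_simp
  have hcauchy :=
    Complex.circleIntegral_sub_center_inv_smul_of_differentiable_on_off_countable_of_tendsto
      one_pos Set.countable_empty hcont (fun z hz ↦ by
        have h0 : z ≠ 0 := hz.1.2
        have := differentiableAt_invLogSub (one_add_mem_slitPlane_of_mem_ball hz.1.1) (hne z h0)
        fun_prop (disch := assumption)) hlim
  have hs : sphere (0 : ℂ) 1 ⊆ closedBall 0 1 \ {0} := fun z hz ↦
    ⟨sphere_subset_closedBall hz, ne_zero_of_mem_unitSphere hz⟩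
  have hpow : ∀ m : ℤ, m ≠ -1 → (∮ z in C((0 : ℂ), 1), z ^ m) = 0 := fun m hm ↦ by
    simpa using circleIntegral.integral_sub_zpow_of_ne hm 0 0 1
  have hm1 : (∮ z in C((0 : ℂ), 1), z⁻¹) = 2 * π * Complex.I := by
    simpa using circleIntegral.integral_sub_center_inv (0 : ℂ) one_ne_zero
  have hint : ∀ m : ℤ, CircleIntegrable (fun z : ℂ ↦ z ^ m) 0 1 := fun m ↦
    (continuousOn_zpow_unitSphere m).circleIntegrable zero_le_one
  have hinvi : CircleIntegrable (fun z : ℂ ↦ z⁻¹) 0 1 := (hinv.mono hs).circleIntegrable zero_le_one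
  have hsplit : (∮ z in C(0, 1), (1 + z ^ (-2 : ℤ)) * invLogSub 0 z) =
      ∮ z in C(0, 1), ((z - 0)⁻¹ • ((z + z⁻¹) * (invLogSub 0 z - z⁻¹ - 2⁻¹)) +
        (z⁻¹ + (2⁻¹ * z ^ (0 : ℤ) + (2⁻¹ * z ^ (-2 : ℤ) + z ^ (-3 : ℤ))))) := by
    refine circleIntegral.integral_congr zero_le_one fun z hz ↦ ?_
    have hz0 := ne_zero_of_mem_unitSphere hz
    rw [show (-2 : ℤ) = -(2 : ℕ) by norm_num, show (-3 : ℤ) = -(3 : ℕ) by norm_num,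
      zpow_neg, zpow_natCast, zpow_neg, zpow_natCast, zpow_zero, smul_eq_mul, sub_zero]
    field_simp
    ring
  have hi1 : CircleIntegrable (fun z : ℂ ↦ 2⁻¹ * z ^ (-2 : ℤ)) 0 1 :=
    (continuousOn_const.mul (continuousOn_zpow_unitSphere _)).circleIntegrable zero_le_one
  have hi0 : CircleIntegrable (fun z : ℂ ↦ 2⁻¹ * z ^ (0 : ℤ)) 0 1 :=
    (continuousOn_const.mul (continuousOn_zpow_unitSphere _)).circleIntegrable zero_le_one
  have hi2 : CircleIntegrable (fun z : ℂ ↦ 2⁻¹ * z ^ (-2 : ℤ) + z ^ (-3 : ℤ)) 0 1 :=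
    hi1.add (hint (-3))
  have hi3 : CircleIntegrable
      (fun z : ℂ ↦ 2⁻¹ * z ^ (0 : ℤ) + (2⁻¹ * z ^ (-2 : ℤ) + z ^ (-3 : ℤ))) 0 1 := hi0.add hi2
  have hi4 : CircleIntegrable
      (fun z : ℂ ↦ z⁻¹ + (2⁻¹ * z ^ (0 : ℤ) + (2⁻¹ * z ^ (-2 : ℤ) + z ^ (-3 : ℤ)))) 0 1 :=
    hinvi.add hi3
  rw [hsplit, circleIntegral.integral_add _ hi4, hcauchy,
    circleIntegral.integral_add hinvi hi3, circleIntegral.integral_add hi0 hi2,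
    circleIntegral.integral_add hi1 (hint _), circleIntegral.integral_const_mul,
    circleIntegral.integral_const_mul, hpow 0 (by norm_num), hpow (-2) (by norm_num),
    hpow (-3) (by norm_num), hm1, smul_eq_mul]
  · ring
  · have hinv0 : ContinuousOn (fun z : ℂ ↦ (z - 0)⁻¹) (sphere 0 1) := by
      simpa using hinv.mono hs
    exact (hinv0.smul (hcont.mono hs)).circleIntegrable zero_le_one

/-- On the unit circle the kernel `1 + z⁻²` becomes `2 cos θ`; for `g` symmetric about the real axis
the contour integral reduces to a quarter of the circle. -/
lemma integral_cos_mul_re_of_circleIntegral {g : ℂ → ℂ} (hg : ContinuousOn g (sphere 0 1))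
    (hconj : ∀ z ∈ sphere (0 : ℂ) 1, g ((starRingEnd ℂ) z) = (starRingEnd ℂ) (g z)) {R : ℂ}
    (hR : (∮ z in C(0, 1), (1 + z ^ (-2 : ℤ)) * g z) = 2 * π * Complex.I * R) :
    ∫ x in (0 : ℝ)..(π / 2), Real.cos (2 * x) * (g (circleMap 0 1 (2 * x))).re =
      π / 4 * R.re := by
  have hmem : ∀ θ, circleMap 0 1 θ ∈ sphere (0 : ℂ) 1 := circleMap_mem_sphere 0 zero_le_one
  have hgc : Continuous fun θ ↦ g (circleMap 0 1 θ) :=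
    hg.comp_continuous (continuous_circleMap 0 1) hmem
  set φ : ℝ → ℝ := fun θ ↦ Real.cos θ * (g (circleMap 0 1 θ)).re with hφ
  have hφc : Continuous φ := Real.continuous_cos.mul (Complex.continuous_re.comp hgc)
  have hcplx : (∫ θ in (0 : ℝ)..(2 * π), (Real.cos θ : ℂ) * g (circleMap 0 1 θ)) = π * R := by
    have h1 : (∮ z in C(0, 1), (1 + z ^ (-2 : ℤ)) * g z) =
        ∫ θ in (0 : ℝ)..(2 * π), (2 * Complex.I) * ((Real.cos θ : ℂ) * g (circleMap 0 1 θ)) := by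
      refine intervalIntegral.integral_congr fun θ _ ↦ ?_
      have h0 := ne_zero_of_mem_unitSphere (hmem θ)
      have hcos : (Real.cos θ : ℂ) = (circleMap 0 1 θ + (circleMap 0 1 θ)⁻¹) / 2 := by
        rw [Complex.ofReal_cos, Complex.cos]
        simp only [circleMap, zero_add, Complex.ofReal_one, one_mul, neg_mul, ← Complex.exp_neg]
      simp only [deriv_circleMap, smul_eq_mul]
      rw [hcos, show (-2 : ℤ) = -(2 : ℕ) by norm_num, zpow_neg, zpow_natCast]
      field_simp
    rw [h1, intervalIntegral.integral_const_mul] at hR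
    have hI : (2 * Complex.I) ≠ 0 := mul_ne_zero two_ne_zero Complex.I_ne_zero
    apply mul_left_cancel₀ hI
    rw [hR]
    ring
  have hfull : ∫ θ in (0 : ℝ)..(2 * π), φ θ = π * R.re := by
    have hcc : Continuous fun θ ↦ (Real.cos θ : ℂ) * g (circleMap 0 1 θ) :=
      (Complex.continuous_ofReal.comp Real.continuous_cos).mul hgc
    have h2 := Complex.reCLM.intervalIntegral_comp_comm
      (hcc.intervalIntegrable (μ := volume) 0 (2 * π))
    simp only [Complex.reCLM_apply, Complex.re_ofReal_mul] at h2
    rw [h2, hcplx, Complex.re_ofReal_mul]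
  have hsymm : ∀ θ, φ (2 * π - θ) = φ θ := fun θ ↦ by
    have hc : circleMap 0 1 (2 * π - θ) = (starRingEnd ℂ) (circleMap 0 1 θ) := by
      simp only [circleMap, zero_add, Complex.ofReal_one, one_mul, ← Complex.exp_conj, map_mul,
        Complex.conj_ofReal, Complex.conj_I]
      push_cast
      rw [sub_mul, Complex.exp_sub, Complex.exp_two_pi_mul_I, one_div, ← Complex.exp_neg, mul_neg]
    simp only [hφ]
    rw [hc, hconj _ (hmem θ), Complex.conj_re, Real.cos_two_pi_sub]
  have hhalf : ∫ θ in (0 : ℝ)..(2 * π), φ θ = 2 * ∫ θ in (0 : ℝ)..π, φ θ := by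
    rw [← intervalIntegral.integral_add_adjacent_intervals (hφc.intervalIntegrable 0 π)
      (hφc.intervalIntegrable π (2 * π))]
    have h3 := intervalIntegral.integral_comp_sub_left (a := 0) (b := π) φ (2 * π)
    rw [show 2 * π - π = π by ring, sub_zero] at h3
    rw [← h3]
    simp only [hsymm]
    ring
  have hscale := intervalIntegral.integral_comp_mul_left (a := 0) (b := π / 2) φ two_ne_zero
  rw [mul_zero, mul_div_cancel₀ π two_ne_zero, smul_eq_mul] at hscale
  rw [hscale]
  linarith

lemma one_add_circleMap_two_mul (x : ℝ) :
    1 + circleMap 0 1 (2 * x) = 2 * Real.cos x * Complex.exp (x * Complex.I) := by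
  have h2 : (2 : ℂ) * Real.cos x =
      Complex.exp (x * Complex.I) + Complex.exp (-(x * Complex.I)) := by
    rw [Complex.ofReal_cos, Complex.cos]
    ring_nf
  rw [h2, add_mul, ← Complex.exp_add, ← Complex.exp_add, neg_add_cancel, Complex.exp_zero]
  simp only [circleMap, zero_add, Complex.ofReal_one, one_mul]
  rw [add_comm]
  congr 2
  push_cast
  ring

/-- The boundary value `log (1 + exp (2 i x)) = log (2 cos x) + i x`. -/
noncomputable def logTwoCos (x : ℝ) : ℂ := Real.log (2 * Real.cos x) + x * Complex.I

lemma logTwoCos_re (x : ℝ) : (logTwoCos x).re = Real.log (2 * Real.cos x) := by simp [logTwoCos]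

lemma logTwoCos_im (x : ℝ) : (logTwoCos x).im = x := by simp [logTwoCos]

lemma cos_pos_of_mem_Ioo {x : ℝ} (hx : x ∈ Set.Ioo 0 (π / 2)) : 0 < Real.cos x :=
  Real.cos_pos_of_mem_Ioo ⟨by linarith [hx.1, Real.pi_pos], hx.2⟩

lemma invLogSub_circleMap_two_mul (c : ℝ) {x : ℝ} (hx : x ∈ Set.Ioo 0 (π / 2)) :
    invLogSub c (circleMap 0 1 (2 * x)) = (logTwoCos x - c)⁻¹ := by
  have hcos := cos_pos_of_mem_Ioo hx
  have hpos : 0 < 2 * Real.cos x := by positivity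
  have hexp : 1 + circleMap 0 1 (2 * x) = Complex.exp (logTwoCos x) := by
    rw [one_add_circleMap_two_mul, logTwoCos, Complex.exp_add, ← Complex.ofReal_exp,
      Real.exp_log hpos]
    push_cast
    rfl
  have hne : circleMap 0 1 (2 * x) ≠ -1 := fun h ↦ by
    rw [h, add_neg_cancel] at hexp
    exact Complex.exp_ne_zero _ hexp.symm
  rw [invLogSub, if_neg hne, hexp, Complex.log_exp]
  · rw [logTwoCos_im]; linarith [hx.1, Real.pi_pos]
  · rw [logTwoCos_im]; linarith [hx.2, Real.pi_pos]

lemma invLogSub_conj (c : ℝ) {z : ℂ} (hz : z ∈ sphere (0 : ℂ) 1) :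
    invLogSub c ((starRingEnd ℂ) z) = (starRingEnd ℂ) (invLogSub c z) := by
  by_cases h : z = -1
  · simp [invLogSub, h]
  · have h' : (starRingEnd ℂ) z ≠ -1 := fun hc ↦ h (by
      simpa using congrArg (starRingEnd ℂ) hc)
    have harg := Complex.slitPlane_arg_ne_pi
      (one_add_mem_slitPlane_of_mem_closedBall (sphere_subset_closedBall hz) h)
    have hlog := Complex.log_conj _ harg
    rw [map_add, map_one] at hlog
    rw [invLogSub, invLogSub, if_neg h, if_neg h', hlog]
    simp

lemma ne_exp_sub_one_of_mem_sphere {c : ℝ} (hc : c < Real.log 2) {z : ℂ}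
    (hz : z ∈ sphere (0 : ℂ) 1) : z ≠ rexp c - 1 := by
  rintro rfl
  have := exp_sub_one_mem_ball hc
  rw [mem_ball_zero_iff] at this
  rw [mem_sphere_zero_iff_norm] at hz
  exact this.ne hz

lemma continuousOn_invLogSub_sphere {c : ℝ} (hc : c ≠ Real.log 2) :
    ContinuousOn (invLogSub c) (sphere 0 1) := fun z hz ↦ by
  refine (continuousAt_invLogSub (sphere_subset_closedBall hz) ?_).continuousWithinAt
  rcases hc.lt_or_gt with h | h
  · exact ne_exp_sub_one_of_mem_sphere h hz
  · exact ne_exp_sub_one_of_mem_closedBall h (sphere_subset_closedBall hz)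

lemma setIntegral_cos_mul_re_inv_logTwoCos_sub {c : ℝ} (hc : c ≠ Real.log 2) {R : ℂ}
    (hR : (∮ z in C(0, 1), (1 + z ^ (-2 : ℤ)) * invLogSub c z) = 2 * π * Complex.I * R) :
    ∫ x in Set.Ioo 0 (π / 2), Real.cos (2 * x) * ((logTwoCos x - c)⁻¹).re = π / 4 * R.re := by
  rw [← integral_cos_mul_re_of_circleIntegral (continuousOn_invLogSub_sphere hc)
    (fun z hz ↦ invLogSub_conj c hz) hR, intervalIntegral.integral_of_le (by positivity),
    integral_Ioc_eq_integral_Ioo]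
  refine setIntegral_congr_fun measurableSet_Ioo fun x hx ↦ ?_
  simp only [invLogSub_circleMap_two_mul c hx]

lemma integrableOn_cos_mul_re_inv_logTwoCos_sub {c : ℝ} (hc : c ≠ Real.log 2) :
    IntegrableOn (fun x ↦ Real.cos (2 * x) * ((logTwoCos x - c)⁻¹).re) (Set.Ioo 0 (π / 2)) := by
  have hcont : Continuous fun x : ℝ ↦
      Real.cos (2 * x) * (invLogSub c (circleMap 0 1 (2 * x))).re := by
    have hgc : Continuous fun θ ↦ invLogSub c (circleMap 0 1 θ) :=
      (continuousOn_invLogSub_sphere hc).comp_continuous (continuous_circleMap 0 1)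
        (circleMap_mem_sphere 0 zero_le_one)
    have : Continuous fun x : ℝ ↦ invLogSub c (circleMap 0 1 (2 * x)) :=
      hgc.comp (continuous_const_mul 2)
    fun_prop
  have hint : IntegrableOn (fun x ↦ Real.cos (2 * x) * (invLogSub c (circleMap 0 1 (2 * x))).re)
      (Set.Ioo 0 (π / 2)) :=
    (hcont.integrableOn_Icc (a := 0) (b := π / 2)).mono_set Set.Ioo_subset_Icc_self
  refine hint.congr_fun (fun x hx ↦ ?_) measurableSet_Ioo
  simp only [invLogSub_circleMap_two_mul c hx]

lemma sq_log_two_mul_cos_le {x : ℝ} (hx : x ∈ Set.Ioo 0 (π / 2)) :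
    Real.log (2 * Real.cos x) ^ 2 ≤ 1 + 16 * (π / 2 - x) ^ (-(1 / 2) : ℝ) := by
  have hcos := cos_pos_of_mem_Ioo hx
  set y := 2 * Real.cos x with hy
  have hy0 : 0 < y := by positivity
  have hy2 : y ≤ 2 := by linarith [Real.cos_le_one x]
  have hyx : π / 2 - x ≤ y := by
    have h1 := Real.mul_le_sin (x := π / 2 - x) (by linarith [hx.2]) (by linarith [hx.1])
    rw [Real.sin_pi_div_two_sub] at h1
    have h2 : 1 / 2 ≤ 2 / π := by
      rw [div_le_div_iff₀ two_pos Real.pi_pos]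
      linarith [Real.pi_le_four]
    have h3 : 0 < π / 2 - x := by linarith [hx.2]
    nlinarith
  have hub : Real.log y ≤ 1 := by
    have := Real.log_le_sub_one_of_pos hy0
    linarith
  set t := y ^ (-(1 / 4) : ℝ) with ht
  have ht0 : 0 < t := Real.rpow_pos_of_pos hy0 _
  have hlb : -(4 * t) ≤ Real.log y := by
    have h1 := Real.log_le_sub_one_of_pos ht0
    rw [ht, Real.log_rpow hy0] at h1
    linarith
  have htt : t ^ 2 ≤ (π / 2 - x) ^ (-(1 / 2) : ℝ) := by
    have h1 : t ^ 2 = y ^ (-(1 / 2) : ℝ) := by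
      rw [ht, ← Real.rpow_natCast, ← Real.rpow_mul hy0.le]
      norm_num
    rw [h1]
    exact Real.rpow_le_rpow_of_nonpos (by linarith [hx.2]) hyx (by norm_num)
  rcases le_total 0 (Real.log y) with h | h
  · nlinarith [sq_nonneg t]
  · nlinarith [sq_nonneg t]

lemma norm_sq_logTwoCos (x : ℝ) :
    ‖logTwoCos x‖ ^ 2 = Real.log (2 * Real.cos x) ^ 2 + x ^ 2 := by
  rw [Complex.sq_norm, Complex.normSq_apply, logTwoCos_re, logTwoCos_im]
  ring

lemma integrableOn_norm_sq_logTwoCos :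
    IntegrableOn (fun x ↦ ‖logTwoCos x‖ ^ 2) (Set.Ioo 0 (π / 2)) := by
  have hrpow : IntegrableOn (fun x : ℝ ↦ (π / 2 - x) ^ (-(1 / 2) : ℝ)) (Set.Ioo 0 (π / 2)) := by
    have h := (intervalIntegral.intervalIntegrable_rpow' (a := 0) (b := π / 2)
      (r := -(1 / 2)) (by norm_num)).comp_sub_left (π / 2)
    rw [sub_zero, sub_self] at h
    exact ((intervalIntegrable_iff_integrableOn_Ioc_of_le (by positivity)).1 h.symm).mono_set
      Set.Ioo_subset_Ioc_self
  have hsq : IntegrableOn (fun x : ℝ ↦ x ^ 2) (Set.Ioo 0 (π / 2)) :=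
    ((continuous_pow 2).integrableOn_Icc (a := 0) (b := π / 2)).mono_set Set.Ioo_subset_Icc_self
  have hone : IntegrableOn (fun _ : ℝ ↦ (1 : ℝ)) (Set.Ioo 0 (π / 2)) :=
    integrableOn_const (by simp)
  have hbound := (hone.add (hrpow.const_mul 16)).add hsq
  refine Integrable.mono' hbound ?_ ?_
  · have : Measurable fun x : ℝ ↦ ‖logTwoCos x‖ ^ 2 := by
      unfold logTwoCos
      fun_prop
    exact this.aestronglyMeasurable
  · filter_upwards [ae_restrict_mem measurableSet_Ioo] with x hx
    rw [Real.norm_of_nonneg (by positivity), norm_sq_logTwoCos]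
    simpa using sq_log_two_mul_cos_le hx

lemma le_norm_logTwoCos_sub {b c : ℝ} (hc : b ≤ c) {x : ℝ} (hx : x ∈ Set.Ioo 0 (π / 2)) :
    b - Real.log 2 ≤ ‖logTwoCos x - c‖ := by
  have hcos := cos_pos_of_mem_Ioo hx
  have hL : Real.log (2 * Real.cos x) ≤ Real.log 2 :=
    Real.log_le_log (by positivity) (by linarith [Real.cos_le_one x])
  have := (neg_le_abs _).trans (Complex.abs_re_le_norm (logTwoCos x - c))
  rw [Complex.sub_re, logTwoCos_re, Complex.ofReal_re] at this
  linarith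

lemma le_norm_logTwoCos_add {b c : ℝ} (hb : 0 < b) (hc : b ≤ c) {x : ℝ}
    (hx : x ∈ Set.Ioo 0 (π / 2)) : min (b / 2) 1 ≤ ‖logTwoCos x + c‖ := by
  have hcos := cos_pos_of_mem_Ioo hx
  have hre := (le_abs_self _).trans (Complex.abs_re_le_norm (logTwoCos x + c))
  have him := (le_abs_self _).trans (Complex.abs_im_le_norm (logTwoCos x + c))
  rw [Complex.add_re, logTwoCos_re, Complex.ofReal_re] at hre
  rw [Complex.add_im, logTwoCos_im, Complex.ofReal_im] at him
  by_cases h1 : 1 ≤ x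
  · exact (min_le_right _ _).trans (by linarith)
  · have hx1 : 1 - x ^ 2 / 2 ≤ Real.cos x := Real.one_sub_sq_div_two_le_cos
    have hL : 0 ≤ Real.log (2 * Real.cos x) := Real.log_nonneg (by nlinarith [hx.1])
    exact (min_le_left _ _).trans (by linarith)

lemma abs_cos_mul_re_inv_add_inv_le {b c δ : ℝ} (hb : Real.log 2 < b) (hc : b ≤ c)
    (hδ : δ = min (b - Real.log 2) (min (b / 2) 1)) {x : ℝ} (hx : x ∈ Set.Ioo 0 (π / 2)) :
    |Real.cos (2 * x) * ((logTwoCos x - c)⁻¹).re + Real.cos (2 * x) * ((logTwoCos x + c)⁻¹).re| ≤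
      (8 / δ + 4) * (1 + ‖logTwoCos x‖ ^ 2) * (c ^ 2)⁻¹ := by
  set w := logTwoCos x with hw
  have hb0 : 0 < b := (Real.log_pos one_lt_two).trans hb
  have hc0 : 0 < c := hb0.trans_le hc
  have hδ0 : 0 < δ := by
    rw [hδ]
    exact lt_min (by linarith) (lt_min (by linarith) one_pos)
  have hsub : δ ≤ ‖w - c‖ := by
    rw [hδ]; exact (min_le_left _ _).trans (le_norm_logTwoCos_sub hc hx)
  have hadd : δ ≤ ‖w + c‖ := by
    rw [hδ]; exact (min_le_right _ _).trans (le_norm_logTwoCos_add hb0 hc hx)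
  have hs0 : w - c ≠ 0 := norm_pos_iff.1 (hδ0.trans_le hsub)
  have ha0 : w + c ≠ 0 := norm_pos_iff.1 (hδ0.trans_le hadd)
  have hnc : ‖(c : ℂ)‖ = c := by rw [Complex.norm_real, Real.norm_of_nonneg hc0.le]
  have hstep : |Real.cos (2 * x) * ((w - c)⁻¹).re + Real.cos (2 * x) * ((w + c)⁻¹).re| ≤
      ‖(w - c)⁻¹ + (w + c)⁻¹‖ := by
    rw [← mul_add, ← Complex.add_re, abs_mul]
    exact (mul_le_of_le_one_left (abs_nonneg _) (Real.abs_cos_le_one _)).trans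
      (Complex.abs_re_le_norm _)
  refine hstep.trans ?_
  have hn := norm_nonneg w
  rcases le_or_gt ‖w‖ (c / 2) with h | h
  · have h1 : c / 2 ≤ ‖w - c‖ := by
      have := norm_sub_norm_le (c : ℂ) w
      rw [hnc, norm_sub_rev] at this
      linarith
    have h2 : c / 2 ≤ ‖w + c‖ := by
      have := norm_sub_le_norm_add (c : ℂ) w
      rw [hnc, add_comm] at this
      linarith
    have heq : (w - c)⁻¹ + (w + c)⁻¹ = 2 * w * ((w - c)⁻¹ * (w + c)⁻¹) := by
      field_simp
      ring
    have hi1 : ‖(w - c)⁻¹‖ ≤ (c / 2)⁻¹ := by rw [norm_inv]; exact inv_anti₀ (by positivity) h1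
    have hi2 : ‖(w + c)⁻¹‖ ≤ (c / 2)⁻¹ := by rw [norm_inv]; exact inv_anti₀ (by positivity) h2
    calc ‖(w - c)⁻¹ + (w + c)⁻¹‖ = 2 * ‖w‖ * (‖(w - c)⁻¹‖ * ‖(w + c)⁻¹‖) := by
          rw [heq]; simp
      _ ≤ 2 * ‖w‖ * ((c / 2)⁻¹ * (c / 2)⁻¹) := by gcongr
      _ = 8 * ‖w‖ * (c ^ 2)⁻¹ := by field_simp; ring
      _ ≤ _ := by
          refine mul_le_mul_of_nonneg_right ?_ (by positivity)
          have : 0 ≤ 8 / δ * (1 + ‖w‖ ^ 2) := by positivity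
          nlinarith [sq_nonneg (‖w‖ - 1)]
  · have hi1 : ‖(w - c)⁻¹‖ ≤ δ⁻¹ := by rw [norm_inv]; exact inv_anti₀ hδ0 hsub
    have hi2 : ‖(w + c)⁻¹‖ ≤ δ⁻¹ := by rw [norm_inv]; exact inv_anti₀ hδ0 hadd
    have h4 : 1 ≤ 4 * ‖w‖ ^ 2 * (c ^ 2)⁻¹ := by
      rw [← div_eq_mul_inv, one_le_div (by positivity)]
      nlinarith
    calc ‖(w - c)⁻¹ + (w + c)⁻¹‖ ≤ δ⁻¹ + δ⁻¹ := norm_add_le_of_le hi1 hi2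
      _ = 2 * δ⁻¹ * 1 := by ring
      _ ≤ 2 * δ⁻¹ * (4 * ‖w‖ ^ 2 * (c ^ 2)⁻¹) := by gcongr
      _ = (8 / δ) * ‖w‖ ^ 2 * (c ^ 2)⁻¹ := by ring
      _ ≤ _ := by gcongr <;> linarith

lemma re_cot_div_two (a b : ℝ) : (Complex.cot ((a + b * Complex.I) / 2)).re =
    Real.sin a / (Real.cosh b - Real.cos a) := by
  set u := a / 2 with hu
  set v := b / 2 with hv
  have ha : a = 2 * u := by rw [hu]; ring
  have hb : b = 2 * v := by rw [hv]; ring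
  have harg : ((a + b * Complex.I) / 2 : ℂ) = u + v * Complex.I := by
    rw [ha, hb]; push_cast; ring
  have hden : Real.cosh b - Real.cos a = 2 *
      (Real.sin u * Real.cosh v * (Real.sin u * Real.cosh v) +
        Real.cos u * Real.sinh v * (Real.cos u * Real.sinh v)) := by
    rw [ha, hb, Real.cosh_two_mul, Real.cos_two_mul]
    linear_combination (1 - 2 * Real.cos u ^ 2) * Real.sinh_sq v -
      2 * Real.cosh v ^ 2 * Real.sin_sq_add_cos_sq u
  have hs : Complex.sin (u + v * Complex.I) =
      ((Real.sin u * Real.cosh v : ℝ) : ℂ) + (Real.cos u * Real.sinh v : ℝ) * Complex.I := by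
    rw [Complex.sin_add_mul_I]; push_cast; ring
  have hc : Complex.cos (u + v * Complex.I) =
      ((Real.cos u * Real.cosh v : ℝ) : ℂ) + (-(Real.sin u * Real.sinh v) : ℝ) * Complex.I := by
    rw [Complex.cos_add_mul_I]; push_cast; ring
  rw [harg, Complex.cot, hs, hc, Complex.div_re, hden, Complex.normSq_add_mul_I, ha,
    Real.sin_two_mul]
  simp only [Complex.add_re, Complex.add_im, Complex.ofReal_re, Complex.ofReal_im,
    Complex.re_ofReal_mul, Complex.im_ofReal_mul, Complex.I_re, Complex.I_im, mul_zero, add_zero,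
    zero_add, mul_one]
  rw [← add_div, mul_assoc 2 (Real.sin u), mul_div_mul_left _ _ two_ne_zero]
  congr 1
  · linear_combination Real.sin u * Real.cos u * Real.cosh_sq v
  · ring

/-- The Mittag-Leffler expansion of `cot (w / (2 α))`, with poles at the multiples of `2 π α`. -/
lemma hasSum_cot_div_two_mul {α : ℝ} (hα : α ≠ 0) {w : ℂ} (hw : w.im ≠ 0) :
    HasSum (fun n : ℕ ↦ (w - (2 * π * α * (n + 1) : ℝ))⁻¹ + (w + (2 * π * α * (n + 1) : ℝ))⁻¹)
      ((2 * α : ℝ)⁻¹ * Complex.cot (w / (2 * α)) - w⁻¹) := by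
  have hα' : (α : ℂ) ≠ 0 := by exact_mod_cast hα
  have hπ : (π : ℂ) ≠ 0 := by exact_mod_cast Real.pi_ne_zero
  have hw0 : w ≠ 0 := fun h ↦ hw (by simp [h])
  have hmem : w / (2 * π * α) ∈ Complex.integerComplement := by
    rintro ⟨n, hn⟩
    apply hw
    have h1 : w = ((n * (2 * π * α) : ℝ) : ℂ) := by
      push_cast
      rw [hn]
      field_simp
    rw [h1, Complex.ofReal_im]
  have h := (summable_cotTerm hmem).hasSum
  rw [← cot_series_rep' hmem] at h
  have h := h.mul_left (2 * π * α : ℂ)⁻¹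
  have hval : (2 * π * α : ℂ)⁻¹ * (π * Complex.cot (π * (w / (2 * π * α))) -
      1 / (w / (2 * π * α))) = (2 * α : ℝ)⁻¹ * Complex.cot (w / (2 * α)) - w⁻¹ := by
    rw [show (π : ℂ) * (w / (2 * π * α)) = w / (2 * α) by field_simp]
    push_cast
    field_simp
  rw [hval] at h
  refine h.congr_fun fun n ↦ ?_
  have h2 : (2 * π * α : ℂ) ≠ 0 := mul_ne_zero (mul_ne_zero two_ne_zero hπ) hα'
  have hscale : ∀ t : ℂ, (2 * π * α : ℂ)⁻¹ * (1 / ((2 * π * α : ℂ)⁻¹ * t)) = t⁻¹ := fun t ↦ by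
    rw [one_div, mul_inv (2 * π * α : ℂ)⁻¹ t, inv_inv, inv_mul_cancel_left₀ h2]
  have e1 : w / (2 * π * α) - (n + 1) = (2 * π * α : ℂ)⁻¹ * (w - (2 * π * α * (n + 1) : ℝ)) := by
    push_cast; field_simp
  have e2 : w / (2 * π * α) + (n + 1) = (2 * π * α : ℂ)⁻¹ * (w + (2 * π * α * (n + 1) : ℝ)) := by
    push_cast; field_simp
  rw [cotTerm, e1, e2, mul_add (2 * π * α : ℂ)⁻¹, hscale, hscale]

lemma hasSum_integral_of_hasSum_sub {X : Type*} [MeasurableSpace X] {μ : Measure X}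
    {f g : X → ℝ} {F : ℕ → X → ℝ} (hf : Integrable f μ) (hF : ∀ n, Integrable (F n) μ)
    (hsum : Summable fun n ↦ ∫ x, ‖F n x‖ ∂μ)
    (hg : ∀ᵐ x ∂μ, HasSum (fun n ↦ F n x) (g x - f x)) :
    HasSum (fun n ↦ ∫ x, F n x ∂μ) (∫ x, g x ∂μ - ∫ x, f x ∂μ) := by
  let G : ℕ → X → ℝ := fun n ↦ Nat.casesOn n f F
  have hG : ∀ n, Integrable (G n) μ := fun n ↦ by
    cases n with
    | zero => exact hf
    | succ n => exact hF n
  have h := hasSum_integral_of_summable_integral_norm hG ((summable_nat_add_iff 1).1 hsum)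
  have hae : ∫ x, ∑' n, G n x ∂μ = ∫ x, g x ∂μ := by
    refine integral_congr_ae ?_
    filter_upwards [hg] with x hx
    have : HasSum (fun n ↦ G n x) (g x) := by
      rw [← hasSum_nat_add_iff' 1]
      simpa [G] using hx
    exact this.tsum_eq
  rw [hae, ← hasSum_nat_add_iff' 1] at h
  simpa [G] using h

lemma sinh_half_sq (c : ℝ) : 4 * Real.sinh (c / 2) ^ 2 = rexp (-c) * (rexp c - 1) ^ 2 := by
  have h1 : rexp c = rexp (c / 2) ^ 2 := by rw [← Real.exp_nat_mul]; congr 1; push_cast; ring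
  have h2 : rexp (-c) = rexp (-(c / 2)) ^ 2 := by
    rw [← Real.exp_nat_mul]; congr 1; push_cast; ring
  have h3 : rexp (c / 2) * rexp (-(c / 2)) = 1 := by rw [← Real.exp_add]; simp
  rw [Real.sinh_eq, h1, h2]
  linear_combination (-(rexp (c / 2) * rexp (-(c / 2)) + 1) * rexp (c / 2) ^ 2 +
    2 * rexp (c / 2) * rexp (-(c / 2))) * h3

lemma one_add_inv_sq_mul_exp_neg {c : ℝ} (hc : c ≠ 0) :
    (1 + ((rexp (-c) - 1) ^ 2)⁻¹) * rexp (-c) =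
      rexp (-c) + 1 / 4 * (1 / Real.sinh (c / 2) ^ 2) := by
  have h1 : rexp (-c) - 1 ≠ 0 := by
    rw [sub_ne_zero, Ne, Real.exp_eq_one_iff]
    simpa using hc
  have h2 : 4 * Real.sinh (c / 2) ^ 2 = rexp c * (rexp (-c) - 1) ^ 2 := by
    have := sinh_half_sq (-c)
    rwa [neg_div, Real.sinh_neg, neg_sq, neg_neg] at this
  have h3 : 1 / 4 * (1 / Real.sinh (c / 2) ^ 2) = rexp (-c) * ((rexp (-c) - 1) ^ 2)⁻¹ := by
    rw [one_div_mul_one_div, h2, one_div, mul_inv, Real.exp_neg]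
  rw [h3]
  ring

lemma summable_one_div_sinh_sq {a : ℝ} (ha : 0 < a) :
    Summable fun n : ℕ ↦ 1 / Real.sinh (a * (n + 1)) ^ 2 := by
  have h : Summable fun n : ℕ ↦ (a ^ 2)⁻¹ * (1 / ((n + 1 : ℕ) : ℝ) ^ 2) :=
    ((summable_nat_add_iff 1).2 hasSum_zeta_two.summable).mul_left _
  refine h.of_nonneg_of_le (fun n ↦ by positivity) fun n ↦ ?_
  have h0 : 0 < a * (n + 1) := by positivity
  have hle : a * (n + 1) ≤ Real.sinh (a * (n + 1)) := Real.self_le_sinh_iff.2 h0.le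
  calc 1 / Real.sinh (a * (n + 1)) ^ 2 ≤ 1 / (a * (n + 1)) ^ 2 := by gcongr
    _ = _ := by push_cast; field_simp

lemma hasSum_exp_neg_mul_succ {b : ℝ} (hb : 0 < b) :
    HasSum (fun n : ℕ ↦ rexp (-(b * (n + 1)))) (1 / (rexp b - 1)) := by
  have hlt : rexp (-b) < 1 := Real.exp_lt_one_iff.2 (by linarith)
  have h := (hasSum_geometric_of_lt_one (Real.exp_pos _).le hlt).mul_left (rexp (-b))
  have hval : rexp (-b) * (1 - rexp (-b))⁻¹ = 1 / (rexp b - 1) := by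
    have h1 : 1 < rexp b := Real.one_lt_exp_iff.2 hb
    have h2 : rexp b - 1 ≠ 0 := by linarith
    rw [Real.exp_neg]
    field_simp
  rw [hval] at h
  refine h.congr_fun fun n ↦ ?_
  rw [← Real.exp_nat_mul, ← Real.exp_add]
  congr 1
  ring

lemma setIntegral_cos_mul_re_inv_logTwoCos :
    ∫ x in Set.Ioo 0 (π / 2), Real.cos (2 * x) * ((logTwoCos x)⁻¹).re = π / 4 * (11 / 12) := by
  have h := setIntegral_cos_mul_re_inv_logTwoCos_sub (Real.log_pos one_lt_two).ne
    circleIntegral_invLogSub_zero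
  have hre : ((11 / 12 : ℂ)).re = 11 / 12 := by
    rw [show (11 / 12 : ℂ) = ((11 / 12 : ℝ) : ℂ) by push_cast; rfl, Complex.ofReal_re]
  simpa only [Complex.ofReal_zero, sub_zero, hre] using h

lemma setIntegral_cos_mul_re_inv_logTwoCos_sub_of_log_two_lt {c : ℝ} (hc : Real.log 2 < c) :
    ∫ x in Set.Ioo 0 (π / 2), Real.cos (2 * x) * ((logTwoCos x - c)⁻¹).re =
      π / 4 * (-(c ^ 2)⁻¹) := by
  have h := setIntegral_cos_mul_re_inv_logTwoCos_sub hc.ne'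
    (circleIntegral_invLogSub_of_log_two_lt hc)
  have hre : (-((c : ℂ) ^ 2)⁻¹).re = -(c ^ 2)⁻¹ := by
    rw [show (-((c : ℂ) ^ 2)⁻¹) = ((-(c ^ 2)⁻¹ : ℝ) : ℂ) by push_cast; rfl, Complex.ofReal_re]
  rwa [hre] at h

lemma setIntegral_cos_mul_re_inv_logTwoCos_add {c : ℝ} (hc : 0 < c) :
    ∫ x in Set.Ioo 0 (π / 2), Real.cos (2 * x) * ((logTwoCos x + c)⁻¹).re =
      π / 4 * (rexp (-c) + 1 / 4 * (1 / Real.sinh (c / 2) ^ 2) - (c ^ 2)⁻¹) := by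
  have h := setIntegral_cos_mul_re_inv_logTwoCos_sub
    ((neg_lt_zero.2 hc).trans (Real.log_pos one_lt_two)).ne
    (circleIntegral_invLogSub_of_neg (neg_lt_zero.2 hc))
  rw [← one_add_inv_sq_mul_exp_neg hc.ne']
  have hre : ((1 + ((rexp (-c) - 1 : ℂ) ^ 2)⁻¹) * rexp (-c) - (((-c : ℝ) : ℂ) ^ 2)⁻¹).re =
      (1 + ((rexp (-c) - 1) ^ 2)⁻¹) * rexp (-c) - (c ^ 2)⁻¹ := by
    rw [← Complex.ofReal_re ((1 + ((rexp (-c) - 1) ^ 2)⁻¹) * rexp (-c) - (c ^ 2)⁻¹)]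
    congr 1
    push_cast
    rw [neg_sq]
  rw [hre] at h
  simpa only [Complex.ofReal_neg, sub_neg_eq_add] using h

lemma integrableOn_cos_mul_re_inv_logTwoCos_add {c : ℝ} (hc : 0 < c) :
    IntegrableOn (fun x ↦ Real.cos (2 * x) * ((logTwoCos x + c)⁻¹).re) (Set.Ioo 0 (π / 2)) := by
  simpa only [Complex.ofReal_neg, sub_neg_eq_add] using
    integrableOn_cos_mul_re_inv_logTwoCos_sub
      ((neg_lt_zero.2 hc).trans (Real.log_pos one_lt_two)).ne

lemma summable_inv_sq_mul_succ (b : ℝ) : Summable fun n : ℕ ↦ ((b * (n + 1)) ^ 2)⁻¹ := by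
  refine (((summable_nat_add_iff 1).2 hasSum_zeta_two.summable).mul_left (b ^ 2)⁻¹).congr
    fun n ↦ ?_
  push_cast
  rw [mul_pow, mul_inv, one_div]

lemma hasSum_inv_sq_mul_succ (b : ℝ) :
    HasSum (fun n : ℕ ↦ ((b * (n + 1)) ^ 2)⁻¹) ((b ^ 2)⁻¹ * (π ^ 2 / 6)) := by
  have h := (hasSum_nat_add_iff' 1).2 hasSum_zeta_two
  simp only [Finset.range_one, Finset.sum_singleton, CharP.cast_eq_zero, ne_eq,
    OfNat.ofNat_ne_zero, not_false_eq_true, zero_pow, div_zero, sub_zero] at h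
  refine (h.mul_left (b ^ 2)⁻¹).congr_fun fun n ↦ ?_
  push_cast
  rw [mul_pow, mul_inv, one_div]

lemma summable_integral_norm_cos_mul_re_inv {b : ℝ} (hb : Real.log 2 < b) :
    Summable fun n : ℕ ↦ ∫ x in Set.Ioo 0 (π / 2),
      ‖Real.cos (2 * x) * ((logTwoCos x - (b * (n + 1) : ℝ))⁻¹).re +
        Real.cos (2 * x) * ((logTwoCos x + (b * (n + 1) : ℝ))⁻¹).re‖ := by
  have hb0 : 0 < b := (Real.log_pos one_lt_two).trans hb
  set δ := min (b - Real.log 2) (min (b / 2) 1) with hδ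
  have hint : IntegrableOn (fun x ↦ (8 / δ + 4) * (1 + ‖logTwoCos x‖ ^ 2)) (Set.Ioo 0 (π / 2)) :=
    ((integrableOn_const (by simp)).add integrableOn_norm_sq_logTwoCos).const_mul _
  refine ((summable_inv_sq_mul_succ b).mul_left
    (∫ x in Set.Ioo 0 (π / 2), (8 / δ + 4) * (1 + ‖logTwoCos x‖ ^ 2))).of_nonneg_of_le
    (fun n ↦ integral_nonneg fun x ↦ norm_nonneg _) fun n ↦ ?_
  have hbn : b ≤ b * (n + 1) := by nlinarith [n.cast_nonneg (α := ℝ)]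
  rw [← integral_mul_const]
  refine integral_mono_of_nonneg (ae_of_all _ fun x ↦ norm_nonneg _) (hint.mul_const _) ?_
  filter_upwards [ae_restrict_mem measurableSet_Ioo] with x hx
  exact abs_cos_mul_re_inv_add_inv_le hb hbn hδ hx

lemma hasSum_cos_mul_re_inv {α : ℝ} (hα : α ≠ 0) {x : ℝ} (hx : x ≠ 0) :
    HasSum (fun n : ℕ ↦
      Real.cos (2 * x) * ((logTwoCos x - (2 * π * α * (n + 1) : ℝ))⁻¹).re +
        Real.cos (2 * x) * ((logTwoCos x + (2 * π * α * (n + 1) : ℝ))⁻¹).re)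
      ((2 * α)⁻¹ * (Real.cos (2 * x) * Real.sin (Real.log (2 * Real.cos x) / α) /
        (Real.cosh (x / α) - Real.cos (Real.log (2 * Real.cos x) / α))) -
        Real.cos (2 * x) * ((logTwoCos x)⁻¹).re) := by
  have hα' : (α : ℂ) ≠ 0 := by exact_mod_cast hα
  have h := (Complex.hasSum_re (hasSum_cot_div_two_mul hα
    (by rwa [logTwoCos_im] : (logTwoCos x).im ≠ 0))).mul_left (Real.cos (2 * x))
  have harg : logTwoCos x / (2 * α) =
      (((Real.log (2 * Real.cos x) / α : ℝ) : ℂ) + (x / α : ℝ) * Complex.I) / 2 := by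
    rw [logTwoCos]
    push_cast
    field_simp
  rw [harg, Complex.sub_re, Complex.re_ofReal_mul, re_cot_div_two] at h
  rw [mul_sub, mul_left_comm, ← mul_div_assoc (Real.cos (2 * x))] at h
  exact h.congr_fun fun n ↦ by rw [Complex.add_re, mul_add (Real.cos (2 * x))]

lemma hasSum_setIntegral_cos_mul_re_inv {b : ℝ} (hb : Real.log 2 < b) :
    HasSum (fun n : ℕ ↦ ∫ x in Set.Ioo 0 (π / 2),
      (Real.cos (2 * x) * ((logTwoCos x - (b * (n + 1) : ℝ))⁻¹).re +
        Real.cos (2 * x) * ((logTwoCos x + (b * (n + 1) : ℝ))⁻¹).re))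
      (π / 4 * (1 / (rexp b - 1) +
        1 / 4 * ∑' n : ℕ, 1 / Real.sinh (b / 2 * (n + 1)) ^ 2 - π ^ 2 / (3 * b ^ 2))) := by
  have hb0 : 0 < b := (Real.log_pos one_lt_two).trans hb
  have h := (((hasSum_exp_neg_mul_succ hb0).add
    ((summable_one_div_sinh_sq (half_pos hb0)).hasSum.mul_left (1 / 4))).sub
    ((hasSum_inv_sq_mul_succ b).mul_left 2)).mul_left (π / 4)
  have hval : π / 4 * (1 / (rexp b - 1) +
      1 / 4 * ∑' n : ℕ, 1 / Real.sinh (b / 2 * (n + 1)) ^ 2 - π ^ 2 / (3 * b ^ 2)) =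
      π / 4 * (1 / (rexp b - 1) + 1 / 4 * ∑' n : ℕ, 1 / Real.sinh (b / 2 * (n + 1)) ^ 2 -
        2 * ((b ^ 2)⁻¹ * (π ^ 2 / 6))) := by
    ring
  rw [hval]
  refine h.congr_fun fun n ↦ ?_
  have hbn : b ≤ b * (n + 1) := by nlinarith [n.cast_nonneg (α := ℝ)]
  rw [integral_add (integrableOn_cos_mul_re_inv_logTwoCos_sub (hb.trans_le hbn).ne')
    (integrableOn_cos_mul_re_inv_logTwoCos_add (hb0.trans_le hbn)),
    setIntegral_cos_mul_re_inv_logTwoCos_sub_of_log_two_lt (hb.trans_le hbn),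
    setIntegral_cos_mul_re_inv_logTwoCos_add (hb0.trans_le hbn), mul_div_right_comm b]
  ring

theorem stmt_11 (α : ℝ) (hα : Real.log 2 / (2*π) < α) :
    ∫ x in (0:ℝ)..(π/2),
        (Real.cos (2*x) * Real.sin (Real.log (2 * Real.cos x) / α))
          / (Real.cosh (x/α) - Real.cos (Real.log (2 * Real.cos x) / α))
      = 11*π*α/24 - π / (24*α) + π*α / (2 * (Real.exp (2*π*α) - 1))
        + (π*α/8) * ∑' n : ℕ, 1 / (Real.sinh (π*α*(n+1)))^2 := by
  have hα0 : 0 < α := (div_pos (Real.log_pos one_lt_two) Real.two_pi_pos).trans hα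
  have hb : Real.log 2 < 2 * π * α := by
    rwa [div_lt_iff₀ Real.two_pi_pos, mul_comm] at hα
  have hb0 : 0 < 2 * π * α := (Real.log_pos one_lt_two).trans hb
  have hbn : ∀ n : ℕ, 2 * π * α ≤ 2 * π * α * (n + 1) := fun n ↦ by
    nlinarith [n.cast_nonneg (α := ℝ)]
  have hf : IntegrableOn (fun x ↦ Real.cos (2 * x) * ((logTwoCos x)⁻¹).re)
      (Set.Ioo 0 (π / 2)) := by
    simpa only [Complex.ofReal_zero, sub_zero] using
      integrableOn_cos_mul_re_inv_logTwoCos_sub (Real.log_pos one_lt_two).ne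
  have h := hasSum_integral_of_hasSum_sub hf
    (fun n ↦ (integrableOn_cos_mul_re_inv_logTwoCos_sub (hb.trans_le (hbn n)).ne').add
      (integrableOn_cos_mul_re_inv_logTwoCos_add (hb0.trans_le (hbn n))))
    (summable_integral_norm_cos_mul_re_inv hb)
    ((ae_restrict_mem measurableSet_Ioo).mono fun x hx ↦
      hasSum_cos_mul_re_inv hα0.ne' hx.1.ne')
  have heq := h.unique (hasSum_setIntegral_cos_mul_re_inv hb)
  rw [setIntegral_cos_mul_re_inv_logTwoCos, integral_const_mul,
    show 2 * π * α / 2 = π * α by ring] at heq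
  rw [intervalIntegral.integral_of_le (by positivity), integral_Ioc_eq_integral_Ioo]
  have hexp : rexp (2 * π * α) - 1 ≠ 0 := by
    linarith [Real.one_lt_exp_iff.2 hb0]
  have hsolve := congrArg (fun t ↦ 2 * α * (t + π / 4 * (11 / 12))) heq
  simp only [sub_add_cancel] at hsolve
  rw [mul_inv_cancel_left₀ (by positivity)] at hsolve
  rw [hsolve]
  field_simp
  ring
end
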